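/- arXiv:0905.4385 — 9 statements merged into one kernel-verified Lean document; each statement's English description precedes it below -/
import Mathlib

section
/- Let E/F be a Galois extension (of arbitrary, possibly infinite, degree) and let G = Gal(E/F) carry the Krull topology. (1) For all subgroups A, B of G with A ≤ B, if A is normal in B then the topological closure of A in G is normal in the topological closure of B in G. (2) For every subgroup H of G, the fixed field of H in E equals the fixed field of the topological closure of H in E, i.e. E^H = E^{cl(H)}. -/
/-- In a topological group, normality of `A` in `B` passes to topological closures. -/
theorem Subgroup.normal_topologicalClosure_subgroupOf {G : Type*} [TopologicalSpace G] [Group G]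
    [IsTopologicalGroup G] {A B : Subgroup G} (hAB : A ≤ B) (hA : (A.subgroupOf B).Normal) :
    (A.topologicalClosure.subgroupOf B.topologicalClosure).Normal := by
  refine (Subgroup.normal_subgroupOf_iff (Subgroup.topologicalClosure_mono hAB)).2 ?_
  intro a b ha hb
  exact map_mem_closure₂ (f := fun a b : G => b * a * b⁻¹) (by fun_prop) ha hb
    fun a ha b hb => (Subgroup.normal_subgroupOf_iff hAB).1 hA a b ha hb

/-- A subgroup of a Galois group and its Krull closure have the same fixed field. -/
theorem IntermediateField.fixedField_topologicalClosure {F E : Type*} [Field F] [Field E]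
    [Algebra F E] [IsGalois F E] (H : Subgroup (E ≃ₐ[F] E)) :
    fixedField H.topologicalClosure = fixedField H := by
  refine le_antisymm (fixedField_antitone H.le_topologicalClosure) ?_
  rw [le_iff_le]
  exact H.topologicalClosure_minimal ((le_iff_le _ _).1 le_rfl)
    (InfiniteGalois.fixingSubgroup_isClosed _)

/-- Let `E/F` be a Galois extension (of arbitrary degree) and let `G = Gal(E/F)` carry the
Krull topology.
(1) For all subgroups `A ≤ B` of `G`, if `A` is normal in `B` then the topological closure
of `A` is normal in the topological closure of `B`.
(2) For every subgroup `H` of `G`, the fixed field of `H` in `E` equals the fixed field of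
the topological closure of `H`. -/
theorem krull_closure_normal_and_fixedField (F E : Type*) [Field F] [Field E]
    [Algebra F E] [IsGalois F E] :
    (∀ A B : Subgroup (E ≃ₐ[F] E), A ≤ B → (A.subgroupOf B).Normal →
      ((A.topologicalClosure).subgroupOf (B.topologicalClosure)).Normal) ∧
    (∀ H : Subgroup (E ≃ₐ[F] E),
      IntermediateField.fixedField H = IntermediateField.fixedField H.topologicalClosure) := by
  exact ⟨fun _ _ hAB hA => Subgroup.normal_topologicalClosure_subgroupOf hAB hA,
    fun H => (IntermediateField.fixedField_topologicalClosure H).symm⟩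
end

section
/- (Théorème de l'écartelé) Let K and L be two fields contained in a common field, let J := K ∩ L, and assume only that the extensions K/J and L/J are Galois, their degrees being arbitrary. Then: (1) for all intermediate fields E and F with J ⊆ E ⊆ K and J ⊆ F ⊆ L, one has KF ∩ EL = EF; (2) for all intermediate fields E and F with K ⊆ E ⊆ KL and L ⊆ F ⊆ KL, one has (K ∩ F)(E ∩ L) = E ∩ F. -/
namespace IntermediateField

variable {J M : Type*} [Field J] [Field M] [Algebra J M] [IsGalois J M]

theorem le_of_fixingSubgroup_le {E F : IntermediateField J M}
    (h : F.fixingSubgroup ≤ E.fixingSubgroup) : E ≤ F := by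
  rw [← InfiniteGalois.fixedField_fixingSubgroup F]
  exact (le_iff_le _ _).2 h

theorem isClosed_fixingSubgroup_sup (E F : IntermediateField J M) [IsGalois J F] :
    IsClosed ((E.fixingSubgroup ⊔ F.fixingSubgroup : Subgroup Gal(M/J)) : Set Gal(M/J)) := by
  rw [Subgroup.mul_normal]
  exact ((InfiniteGalois.fixingSubgroup_isClosed E).isCompact.mul
    (InfiniteGalois.fixingSubgroup_isClosed F).isCompact).isClosed

/-- The fixing subgroup of an intersection is generated by the two fixing subgroups, with no
closure needed when one of the extensions is Galois. -/
theorem fixingSubgroup_inf_of_isGalois (E F : IntermediateField J M) [IsGalois J F] :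
    (E ⊓ F).fixingSubgroup = E.fixingSubgroup ⊔ F.fixingSubgroup := by
  let H : ClosedSubgroup Gal(M/J) :=
    ⟨E.fixingSubgroup ⊔ F.fixingSubgroup, isClosed_fixingSubgroup_sup E F⟩
  refine le_antisymm ?_ (sup_le (fixingSubgroup_le inf_le_left) (fixingSubgroup_le inf_le_right))
  change _ ≤ H.1
  rw [← InfiniteGalois.fixingSubgroup_fixedField H]
  apply fixingSubgroup_le
  refine le_inf (le_of_fixingSubgroup_le ?_) (le_of_fixingSubgroup_le ?_) <;>
    rw [InfiniteGalois.fixingSubgroup_fixedField H]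
  exacts [le_sup_left, le_sup_right]

theorem exists_mul_of_mem_fixingSubgroup_inf {E F : IntermediateField J M} [IsGalois J F]
    {σ : Gal(M/J)} (hσ : σ ∈ (E ⊓ F).fixingSubgroup) :
    ∃ τ ∈ E.fixingSubgroup, ∃ ρ ∈ F.fixingSubgroup, τ * ρ = σ := by
  rwa [fixingSubgroup_inf_of_isGalois, Subgroup.mem_sup_of_normal_right] at hσ

variable {K L : IntermediateField J M} [IsGalois J L]

theorem sup_inf_sup_eq_sup (hKL : K ⊓ L = ⊥) {E F : IntermediateField J M}
    (hE : E ≤ K) (hF : F ≤ L) : (K ⊔ F) ⊓ (E ⊔ L) = E ⊔ F := by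
  refine le_antisymm (le_of_fixingSubgroup_le fun σ hσ ↦ ?_)
    (sup_le (le_inf (hE.trans le_sup_left) le_sup_left)
      (le_inf le_sup_right (hF.trans le_sup_right)))
  obtain ⟨τ, hτ, ρ, hρ, rfl⟩ : ∃ τ ∈ K.fixingSubgroup, ∃ ρ ∈ L.fixingSubgroup, τ * ρ = σ :=
    exists_mul_of_mem_fixingSubgroup_inf (by simp [hKL])
  rw [fixingSubgroup_sup] at hσ
  have hτF : τ ∈ F.fixingSubgroup :=
    (Subgroup.mul_mem_cancel_right _ (fixingSubgroup_le hF hρ)).1 hσ.2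
  have hρE : ρ ∈ E.fixingSubgroup :=
    (Subgroup.mul_mem_cancel_left _ (fixingSubgroup_le hE hτ)).1 hσ.1
  refine mul_mem (fixingSubgroup_le inf_le_left ?_) (fixingSubgroup_le inf_le_right ?_) <;>
    rw [fixingSubgroup_sup]
  exacts [⟨hτ, hτF⟩, ⟨hρE, hρ⟩]

/-- A field between `K` and `KL` is generated over `K` by its intersection with `L`. -/
theorem sup_inf_eq_of_le (hKL : K ⊔ L = ⊤) {E : IntermediateField J M} (hE : K ≤ E) :
    K ⊔ (E ⊓ L) = E := by
  refine le_antisymm (sup_le hE inf_le_left) (le_of_fixingSubgroup_le fun σ hσ ↦ ?_)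
  rw [fixingSubgroup_sup] at hσ
  obtain ⟨τ, hτ, ρ, hρ, rfl⟩ := exists_mul_of_mem_fixingSubgroup_inf hσ.2
  have hρK : ρ ∈ K.fixingSubgroup :=
    (Subgroup.mul_mem_cancel_left _ (fixingSubgroup_le hE hτ)).1 hσ.1
  have hρ1 : ρ ∈ (K ⊔ L).fixingSubgroup := by
    rw [fixingSubgroup_sup]
    exact ⟨hρK, hρ⟩
  rw [hKL] at hρ1
  exact mul_mem hτ (fixingSubgroup_le le_top hρ1)

theorem inf_sup_inf_eq_inf [IsGalois J K] (hbot : K ⊓ L = ⊥) (htop : K ⊔ L = ⊤)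
    {E F : IntermediateField J M} (hE : K ≤ E) (hF : L ≤ F) :
    (K ⊓ F) ⊔ (E ⊓ L) = E ⊓ F := by
  have hE' := sup_inf_eq_of_le htop hE
  have hF' := sup_inf_eq_of_le (sup_comm K L ▸ htop) hF
  rw [← sup_inf_sup_eq_sup hbot inf_le_left inf_le_right, hE', sup_comm, inf_comm K F, hF']

end IntermediateField

/-- Théorème de l'écartelé.  Let `K` and `L` be two fields contained in a common field `Ω`,
with `J := K ∩ L` (here `J` is the base field and `K ⊓ L = ⊥`), and assume only that `K/J`
and `L/J` are Galois, of arbitrary degree.  Then: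
(1) for all intermediate fields `J ⊆ E ⊆ K` and `J ⊆ F ⊆ L`, one has `KF ∩ EL = EF`;
(2) for all intermediate fields `K ⊆ E ⊆ KL` and `L ⊆ F ⊆ KL`, one has
`(K ∩ F)(E ∩ L) = E ∩ F`. -/
theorem ecartele (J Ω : Type*) [Field J] [Field Ω] [Algebra J Ω]
    (K L : IntermediateField J Ω) (hJ : K ⊓ L = ⊥)
    (hK : IsGalois J K) (hL : IsGalois J L) :
    (∀ E F : IntermediateField J Ω, E ≤ K → F ≤ L →
      (K ⊔ F) ⊓ (E ⊔ L) = E ⊔ F) ∧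
    (∀ E F : IntermediateField J Ω, K ≤ E → E ≤ K ⊔ L → L ≤ F → F ≤ K ⊔ L →
      (K ⊓ F) ⊔ (E ⊓ L) = E ⊓ F) := by
  have : IsGalois J ↥(K ⊔ L) := ⟨⟩
  have hlift {X : IntermediateField J Ω} (hX : X ≤ K ⊔ L) :
      ∃ X' : IntermediateField J ↥(K ⊔ L), IntermediateField.lift X' = X :=
    ⟨_, IntermediateField.lift_restrict hX⟩
  obtain ⟨K', hK'⟩ := hlift le_sup_left
  obtain ⟨L', hL'⟩ := hlift le_sup_right
  have : IsGalois J K' :=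
    .of_algEquiv ((IntermediateField.equivOfEq hK'.symm).trans
      (IntermediateField.liftAlgEquiv K').symm)
  have : IsGalois J L' :=
    .of_algEquiv ((IntermediateField.equivOfEq hL'.symm).trans
      (IntermediateField.liftAlgEquiv L').symm)
  have hbot : K' ⊓ L' = ⊥ := by
    rw [← IntermediateField.lift_inj, IntermediateField.lift_inf, IntermediateField.lift_bot,
      hK', hL', hJ]
  have htop : K' ⊔ L' = ⊤ := by
    rw [← IntermediateField.lift_inj, IntermediateField.lift_sup, IntermediateField.lift_top,
      hK', hL']
  have hle {X Y : IntermediateField J ↥(K ⊔ L)}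
      (h : IntermediateField.lift X ≤ IntermediateField.lift Y) : X ≤ Y :=
    fun x hx ↦ (IntermediateField.mem_lift x).1 (h ((IntermediateField.mem_lift x).2 hx))
  constructor
  · intro E F hE hF
    obtain ⟨E, rfl⟩ := hlift (hE.trans le_sup_left)
    obtain ⟨F, rfl⟩ := hlift (hF.trans le_sup_right)
    have h := congrArg IntermediateField.lift (IntermediateField.sup_inf_sup_eq_sup hbot
      (hle (hE.trans_eq hK'.symm)) (hle (hF.trans_eq hL'.symm)))
    simpa only [IntermediateField.lift_inf, IntermediateField.lift_sup, hK', hL'] using h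
  · intro E F hE hEKL hF hFKL
    obtain ⟨E, rfl⟩ := hlift hEKL
    obtain ⟨F, rfl⟩ := hlift hFKL
    have h := congrArg IntermediateField.lift (IntermediateField.inf_sup_inf_eq_inf hbot htop
      (hle (hK'.trans_le hE)) (hle (hL'.trans_le hF)))
    simpa only [IntermediateField.lift_inf, IntermediateField.lift_sup, hK', hL'] using h
end

section
/- Let K/J and L/J be algebraic field extensions such that K and L are contained in a common field. If the extension L/J is galtourable, then the translated extension KL/K is galtourable. -/
/-- A Galois tower of the extension `L/K`: a finite increasing chain of intermediate
fields from `K` (i.e. `⊥`) to `L` (i.e. `⊤`) each of whose steps is a Galois extension. -/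
def IsGaloisTower {K L : Type*} [Field K] [Field L] [Algebra K L] {m : ℕ}
    (F : Fin (m + 1) → IntermediateField K L) : Prop :=
  Monotone F ∧ F 0 = ⊥ ∧ F (Fin.last m) = ⊤ ∧
    ∀ i : Fin m, ∀ h : F i.castSucc ≤ F i.succ,
      IsGalois (F i.castSucc) (IntermediateField.extendScalars h)

/-- An extension `L/K` is galtourable if it admits a Galois tower. -/
def Galtourable (K L : Type*) [Field K] [Field L] [Algebra K L] : Prop :=
  ∃ (m : ℕ) (F : Fin (m + 1) → IntermediateField K L), IsGaloisTower F

/-- Galois extensions are stable under translation: if `E/F` is Galois and `E'` is generated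
over `F'` by the image of `E`, where `F → F'` is compatible with `E → E'`, then `E'/F'` is
Galois. -/
theorem IsGalois.of_adjoin_range_eq_top {F E F' E' : Type*} [Field F] [Field E] [Field F']
    [Field E'] [Algebra F E] [Algebra F' E'] [IsGalois F E] (f : F →+* F') (g : E →+* E')
    (hfg : ∀ a, g (algebraMap F E a) = algebraMap F' E' (f a))
    (h : IntermediateField.adjoin F' (Set.range g) = ⊤) : IsGalois F' E' := by
  have hcomp : g.comp (algebraMap F E) = (algebraMap F' E').comp f := RingHom.ext hfg
  have hroot (x : E) : Polynomial.aeval (g x) ((minpoly F x).map f) = 0 := by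
    rw [Polynomial.aeval_def, Polynomial.eval₂_map, ← hcomp, ← Polynomial.hom_eval₂,
      ← Polynomial.aeval_def, minpoly.aeval, map_zero]
  have hint (x : E) : IsIntegral F' (g x) :=
    ⟨(minpoly F x).map f, (minpoly.monic (IsGalois.integral F x)).map f, hroot x⟩
  have hdvd (x : E) : minpoly F' (g x) ∣ (minpoly F x).map f := minpoly.dvd _ _ (hroot x)
  have hsep (x : E) : IsSeparable F' (g x) :=
    (Polynomial.Separable.map (IsGalois.separable F x)).of_dvd (hdvd x)
  have hsplits (x : E) : ((minpoly F' (g x)).map (algebraMap F' E')).Splits := by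
    have key : (((minpoly F x).map f).map (algebraMap F' E')).Splits := by
      rw [Polynomial.map_map, ← hcomp, ← Polynomial.map_map]
      exact (IsGalois.splits F x).map g
    exact key.of_dvd
      (Polynomial.map_ne_zero (Polynomial.map_ne_zero (minpoly.ne_zero (IsGalois.integral F x))))
      (Polynomial.map_dvd _ (hdvd x))
  have hmem (y : E') : y ∈ IntermediateField.adjoin F' (Set.range g) := h ▸ trivial
  have hseparable : Algebra.IsSeparable F' E' := by
    have : Algebra.IsSeparable F' (IntermediateField.adjoin F' (Set.range g)) :=
      (IntermediateField.isSeparable_adjoin_iff_isSeparable F' E').2 (by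
        rintro _ ⟨x, rfl⟩; exact hsep x)
    rw [h] at this
    exact Algebra.IsSeparable.of_equiv_equiv (RingEquiv.refl F')
      (IntermediateField.topEquiv (F := F') (E := E')).toRingEquiv rfl
  have hnormal : Normal F' E' := normal_iff.2 fun y =>
    ⟨Algebra.IsSeparable.isIntegral F' y, IntermediateField.splits_of_mem_adjoin F' E'
      (by rintro _ ⟨x, rfl⟩; exact ⟨hint x, hsplits x⟩) (hmem y)⟩
  exact ⟨⟩

/-- If `K/J` and `L/J` are algebraic extensions contained in a common field and `L/J` is
galtourable, then the translated extension `KL/K` is galtourable. -/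
theorem galtourable_translate (J Ω : Type*) [Field J] [Field Ω] [Algebra J Ω]
    (K L : IntermediateField J Ω)
    (hKalg : Algebra.IsAlgebraic J K) (hLalg : Algebra.IsAlgebraic J L)
    (hL : Galtourable J L) :
    Galtourable K (IntermediateField.extendScalars (le_sup_left : K ≤ K ⊔ L)) := by
  obtain ⟨m, F, hmono, hbot, htop, hgal⟩ := hL
  set M := IntermediateField.extendScalars (le_sup_left : K ≤ K ⊔ L)
  let ι : L →ₐ[J] M := IntermediateField.inclusion (le_sup_right : L ≤ K ⊔ L)
  let G (i : Fin (m + 1)) : IntermediateField K M := IntermediateField.adjoin K (ι '' F i)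
  have hG : Monotone G := fun i j hij =>
    IntermediateField.adjoin.mono K _ _ (Set.image_mono (hmono hij))
  have hιG (i : Fin (m + 1)) (x : F i) : ι x ∈ G i :=
    IntermediateField.subset_adjoin K _ ⟨x, x.2, rfl⟩
  refine ⟨m, G, hG, ?_, ?_, fun i h => ?_⟩
  · refine IntermediateField.adjoin_eq_bot_iff.2 ?_
    rintro _ ⟨x, hx, rfl⟩
    rw [hbot] at hx
    obtain ⟨a, rfl⟩ := IntermediateField.mem_bot.1 hx
    exact IntermediateField.mem_bot.2 ⟨algebraMap J K a, rfl⟩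
  · have hle : K ⊔ L ≤ ((G (Fin.last m)).map M.val).restrictScalars J := by
      refine sup_le (fun x hx => ?_) (fun x hx => ?_)
      · exact IntermediateField.algebraMap_mem ((G (Fin.last m)).map M.val) ⟨x, hx⟩
      · exact ⟨ι ⟨x, hx⟩, hιG (Fin.last m) ⟨⟨x, hx⟩, htop ▸ trivial⟩, rfl⟩
    refine eq_top_iff.2 fun x _ => ?_
    obtain ⟨y, hy, hyx⟩ := hle x.2
    rwa [← Subtype.ext (hyx : (y : Ω) = x)]
  · have hF : F i.castSucc ≤ F i.succ := hmono i.castSucc_le_succ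
    have := hgal i hF
    let f : F i.castSucc →+* G i.castSucc :=
      (ι.toRingHom.comp (algebraMap (F i.castSucc) L)).codRestrict _ (hιG _)
    let g : IntermediateField.extendScalars hF →+* IntermediateField.extendScalars h :=
      (ι.toRingHom.comp (algebraMap (F i.succ) L)).codRestrict
        (IntermediateField.extendScalars h) (hιG i.succ)
    refine IsGalois.of_adjoin_range_eq_top f g (fun _ => rfl) (eq_top_iff.2 ?_)
    set N := IntermediateField.adjoin (G i.castSucc) (Set.range g)
    have hle : G i.succ ≤
        (N.map (IntermediateField.extendScalars h).val).restrictScalars K := by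
      refine IntermediateField.adjoin_le_iff.2 ?_
      rintro _ ⟨x, hx, rfl⟩
      exact ⟨g ⟨x, hx⟩, IntermediateField.subset_adjoin _ _ ⟨_, rfl⟩, rfl⟩
    intro x _
    obtain ⟨y, hy, hyx⟩ := hle x.2
    rwa [← Subtype.ext (hyx : (y : M) = x)]
end

section
/- Let L/K be a galtourable extension. Then for every intermediate field M with K ≤ M ≤ L, the sub-extension L/M is galtourable. -/
/-- Galois extensions are stable under base change inside a common overfield, with no finiteness
assumption: if `B/A` is Galois, then so is the compositum of `B` and `C` over `C`. -/
theorem IsGalois.adjoin_of_isScalarTower {A C L : Type*} [Field A] [Field C] [Field L]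
    [Algebra A C] [Algebra C L] [Algebra A L] [IsScalarTower A C L]
    (B : IntermediateField A L) [IsGalois A B] :
    IsGalois C (IntermediateField.adjoin C (B : Set L)) := by
  have separable : ∀ x ∈ (B : Set L), IsSeparable C x := fun x hx ↦
    ((Algebra.IsSeparable.isSeparable A (⟨x, hx⟩ : B)).map B.val
      Subtype.val_injective).tower_top C
  have splits : ∀ x ∈ (B : Set L), IsIntegral C x ∧ ((minpoly C x).map
      (algebraMap C (IntermediateField.adjoin C (B : Set L)))).Splits := by
    intro x hx
    refine ⟨(separable x hx).isIntegral, ?_⟩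
    let j : B →+* IntermediateField.adjoin C (B : Set L) :=
      B.val.toRingHom.codRestrict _ fun y ↦ IntermediateField.subset_adjoin C _ y.2
    have hj : j.comp (algebraMap A B) =
        (algebraMap C (IntermediateField.adjoin C (B : Set L))).comp (algebraMap A C) := by
      ext a
      exact IsScalarTower.algebraMap_apply A C L a
    have hs := ((Normal.splits (F := A) (K := B) inferInstance ⟨x, hx⟩).map j)
    rw [IntermediateField.minpoly_eq, Polynomial.map_map, hj, ← Polynomial.map_map] at hs
    have hint : IsIntegral A x :=
      (IsGalois.integral A (⟨x, hx⟩ : B)).map B.val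
    exact hs.of_dvd (Polynomial.map_ne_zero (Polynomial.map_ne_zero (minpoly.ne_zero hint)))
      (Polynomial.map_dvd _ (minpoly.dvd_map_of_isScalarTower A C x))
  have : Algebra.IsSeparable C (IntermediateField.adjoin C (B : Set L)) :=
    (IntermediateField.isSeparable_adjoin_iff_isSeparable C L).2 separable
  have : Normal C (IntermediateField.adjoin C (B : Set L)) := normal_iff.2 fun x ↦
    ⟨Algebra.IsIntegral.isIntegral x, by
      rw [IntermediateField.minpoly_eq]
      exact IntermediateField.splits_of_mem_adjoin C L splits x.2⟩
  exact ⟨⟩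

/-- Every sub-extension of a galtourable extension is galtourable: if `L/K` is galtourable
then for every intermediate field `M` of `L/K`, the extension `L/M` is galtourable. -/
theorem galtourable_subextension (K L : Type*) [Field K] [Field L] [Algebra K L]
    (h : Galtourable K L) (M : IntermediateField K L) :
    Galtourable M L := by
  obtain ⟨m, F, hmono, hbot, htop, hgal⟩ := h
  refine ⟨m, fun i ↦ IntermediateField.adjoin M (F i : Set L), ?_, ?_, ?_, ?_⟩
  · exact fun i j hij ↦ IntermediateField.adjoin.mono M _ _ (hmono hij)
  · simp only [hbot, IntermediateField.adjoin_eq_bot_iff]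
    rintro x ⟨k, rfl⟩
    exact ⟨algebraMap K M k, rfl⟩
  · simp [htop]
  · intro i h
    have hle : F i.castSucc ≤ F i.succ := hmono i.castSucc_le_succ
    have := hgal i hle
    let f : F i.castSucc →+* IntermediateField.adjoin M (F i.castSucc : Set L) :=
      (F i.castSucc).val.toRingHom.codRestrict _ fun y ↦
        IntermediateField.subset_adjoin M _ y.2
    let := f.toAlgebra
    have : IsScalarTower (F i.castSucc) (IntermediateField.adjoin M (F i.castSucc : Set L)) L :=
      .of_algebraMap_eq fun _ ↦ rfl
    rw [IntermediateField.extendScalars_adjoin h]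
    exact IsGalois.adjoin_of_isScalarTower (IntermediateField.extendScalars hle)
end

section
/- The extension ℚ(2^{1/6})/ℚ, where 2^{1/6} denotes the real sixth root of 2, is not galtourable: there exists no finite chain of intermediate fields ℚ = F_0 ≤ F_1 ≤ … ≤ F_m = ℚ(2^{1/6}) in which every step F_{i+1}/F_i is a Galois extension. -/
/-- An element of a Galois extension is in the base field if some power of it is in the base field
and that power map is injective. -/
theorem IsGalois.mem_range_algebraMap_of_pow_mem {K L : Type*} [Field K] [Field L] [Algebra K L]
    [IsGalois K L] {n : ℕ} (hn : Function.Injective fun y : L ↦ y ^ n) {x : L}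
    (hx : x ^ n ∈ Set.range (algebraMap K L)) : x ∈ Set.range (algebraMap K L) := by
  obtain ⟨r, hr⟩ := hx
  refine (InfiniteGalois.mem_range_algebraMap_iff_fixed x).2 fun σ ↦ hn ?_
  simp only [← map_pow, ← hr, AlgEquiv.commutes]

/-- If `L/K` is galtourable and the `n`-th power map of `L` is injective, then an element of `L`
whose `n`-th power lies in `K` already lies in `K`. -/
theorem Galtourable.mem_bot_of_pow_mem {K L : Type*} [Field K] [Field L] [Algebra K L]
    (h : Galtourable K L) {n : ℕ} (hn : Function.Injective fun y : L ↦ y ^ n) {x : L}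
    (hx : x ^ n ∈ (⊥ : IntermediateField K L)) : x ∈ (⊥ : IntermediateField K L) := by
  obtain ⟨m, F, hmono, h0, hlast, hF⟩ := h
  by_contra hx0
  have hmem (i : Fin (m + 1)) : x ∉ F i := by
    induction i using Fin.induction with
    | zero => rwa [h0]
    | succ i ih =>
      intro hxi
      have hle : F i.castSucc ≤ F i.succ := hmono i.castSucc_lt_succ.le
      have := hF i hle
      obtain ⟨r, hr⟩ := IsGalois.mem_range_algebraMap_of_pow_mem
        (K := F i.castSucc) (L := IntermediateField.extendScalars hle) (n := n)
        (x := ⟨x, hxi⟩) (fun a b hab ↦ Subtype.ext (hn (congrArg Subtype.val hab)))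
        ⟨⟨x ^ n, (bot_le : ⊥ ≤ F i.castSucc) hx⟩, rfl⟩
      apply ih
      have hr' : (r : L) = x := congrArg Subtype.val hr
      exact hr' ▸ r.2
  exact hmem (Fin.last m) (hlast ▸ IntermediateField.mem_top)

/-- The extension `ℚ(2^{1/6})/ℚ`, where `2^{1/6}` is the real sixth root of `2`, is not
galtourable. -/
theorem not_galtourable_sixthRootTwo :
    ¬ Galtourable ℚ (IntermediateField.adjoin ℚ {(2 : ℝ) ^ ((1 : ℝ) / 6)}) := by
  intro h
  set a : ℝ := (2 : ℝ) ^ ((1 : ℝ) / 6) with ha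
  have ha6 : (a ^ 2) ^ 3 = 2 := by
    rw [← pow_mul, ha, ← Real.rpow_natCast, ← Real.rpow_mul (by norm_num)]
    norm_num
  let x : IntermediateField.adjoin ℚ {a} := ⟨a, IntermediateField.mem_adjoin_simple_self ℚ a⟩
  have hx : (x ^ 2) ^ 3 = 2 := Subtype.ext ha6
  have hinj : Function.Injective fun y : IntermediateField.adjoin ℚ {a} ↦ y ^ 3 := fun y z hyz ↦
    Subtype.ext ((Odd.strictMono_pow (by decide : Odd 3)).injective (congrArg Subtype.val hyz))
  obtain ⟨q, hq⟩ := IntermediateField.mem_bot.1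
    (h.mem_bot_of_pow_mem hinj (x := x ^ 2) (hx ▸ ofNat_mem _ 2))
  have hqa : (q : ℝ) = a ^ 2 := congrArg Subtype.val hq
  refine irrational_nrt_of_notint_nrt 3 2 (x := a ^ 2) (by exact_mod_cast ha6) ?_ (by norm_num)
    ⟨q, hqa⟩
  rintro ⟨k, hk⟩
  have hk3 : k ^ 3 = 2 := by
    rw [hk] at ha6
    exact_mod_cast ha6
  have h1 : 1 < k := (Odd.strictMono_pow (by decide : Odd 3)).lt_iff_lt.1 (by rw [hk3]; norm_num)
  nlinarith [sq_nonneg k]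
end

section
/- (First dissociation theorem, 'Galschreier') Let L/K be a galtourable extension of arbitrary, possibly infinite, degree, and let (T^1) and (T^2) be two Galois towers of L/K. Then there exist Galois towers (T'^1) and (T'^2) of L/K such that (T'^1) refines (T^1), (T'^2) refines (T^2), and (T'^1) and (T'^2) are equivalent. -/
/-- A tower `E` (with `n` steps) refines a tower `F` (with `m` steps) of the same
extension if the fields of `F` appear, in order, among the fields of `E`. -/
def Refines {K L : Type*} [Field K] [Field L] [Algebra K L] {m n : ℕ}
    (E : Fin (n + 1) → IntermediateField K L)
    (F : Fin (m + 1) → IntermediateField K L) : Prop :=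
  ∃ j : Fin (m + 1) → Fin (n + 1), StrictMono j ∧ ∀ i, F i = E (j i)

/-- Two Galois towers are equivalent if they have the same number of steps and, up to a
permutation of the steps, the Galois groups of corresponding steps are isomorphic as
topological groups (for their Krull topologies). -/
def TowerEquiv {K L : Type*} [Field K] [Field L] [Algebra K L] {m n : ℕ}
    (F : Fin (m + 1) → IntermediateField K L)
    (E : Fin (n + 1) → IntermediateField K L) : Prop :=
  ∃ σ : Fin m ≃ Fin n, ∀ i : Fin m,
    ∀ (hF : F i.castSucc ≤ F i.succ) (hE : E (σ i).castSucc ≤ E (σ i).succ),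
      ∃ e : (↥(IntermediateField.extendScalars hF) ≃ₐ[↥(F i.castSucc)]
              ↥(IntermediateField.extendScalars hF)) ≃*
            (↥(IntermediateField.extendScalars hE) ≃ₐ[↥(E (σ i).castSucc)]
              ↥(IntermediateField.extendScalars hE)),
        Continuous e ∧ Continuous e.symm

section GaloisTowers

open IntermediateField Polynomial

theorem IntermediateField.exists_finite_adjoin_eq {F E : Type*} [Field F] [Field E] [Algebra F E]
    (S : IntermediateField F E) [FiniteDimensional F S] :
    ∃ t : Set E, t.Finite ∧ adjoin F t = S :=
  fg_def.1 (fg_of_fg_toSubalgebra _ (S.toSubalgebra.fg_of_fg_toSubmodule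
    ((Submodule.fg_top _).1 (Module.Finite.fg_top : (⊤ : Submodule F S).FG))))

section BaseChange

variable (F K L E : Type*) [Field F] [Field K] [Field L] [Field E]
  [Algebra F K] [Algebra F L] [Algebra F E] [Algebra K E] [Algebra L E]
  [IsScalarTower F K E] [IsScalarTower F L E]

theorem algebraMap_restrictRestrictAlgEquivMapHom [Normal F K] (σ : Gal(E/L)) (x : K) :
    algebraMap K E (restrictRestrictAlgEquivMapHom F K L E σ x) = σ (algebraMap K E x) :=
  AlgEquiv.restrictNormal_commutes (MulSemiringAction.toAlgAut Gal(E/L) F E σ) K x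

theorem continuous_restrictRestrictAlgEquivMapHom [Normal F K] [Algebra.IsIntegral L E] :
    Continuous (restrictRestrictAlgEquivMapHom F K L E) := by
  refine continuous_of_continuousAt_one _ fun s hs ↦ ?_
  rw [map_one, krullTopology_mem_nhds_one_iff] at hs
  obtain ⟨S, _, hS⟩ := hs
  obtain ⟨t, ht, rfl⟩ := S.exists_finite_adjoin_eq
  have hopen : IsOpen (⋂ x ∈ t,
      (MulAction.stabilizer Gal(E/L) (algebraMap K E x) : Set Gal(E/L))) :=
    ht.isOpen_biInter fun x _ ↦ stabilizer_isOpen_of_isIntegral _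
  refine Filter.mem_map.2 <| Filter.mem_of_superset
    (hopen.mem_nhds (Set.mem_iInter₂.2 fun _ _ ↦ one_mem _)) fun σ hσ ↦ hS ?_
  rw [SetLike.mem_coe, IntermediateField.mem_fixingSubgroup_iff]
  refine (forall_mem_adjoin_smul_eq_self_iff F
    (restrictRestrictAlgEquivMapHom F K L E σ)).2 fun x hx ↦ (algebraMap K E).injective ?_
  have := Set.mem_iInter₂.1 hσ x hx
  rw [AlgEquiv.smul_def, algebraMap_restrictRestrictAlgEquivMapHom]
  simpa using this

/-- Infinite Galois theory version of the theorem on natural irrationalities. -/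
theorem exists_galois_baseChange_equiv [IsGalois F K] [IsGalois L E]
    (hinf : ∀ (x : K) (y : L), algebraMap K E x = algebraMap L E y →
      x ∈ Set.range (algebraMap F K))
    (hsup : adjoin L (Set.range (algebraMap K E)) = ⊤) :
    ∃ e : Gal(E/L) ≃* Gal(K/F), Continuous e ∧ Continuous e.symm ∧
      ∀ σ x, algebraMap K E (e σ x) = σ (algebraMap K E x) := by
  let f := restrictRestrictAlgEquivMapHom F K L E
  have hf (σ x) : algebraMap K E (f σ x) = σ (algebraMap K E x) :=
    algebraMap_restrictRestrictAlgEquivMapHom F K L E σ x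
  have hcont : Continuous f := continuous_restrictRestrictAlgEquivMapHom F K L E
  have : T2Space Gal(K/F) := krullTopology_t2
  have hinj : Function.Injective f := by
    refine (injective_iff_map_eq_one f).2 fun σ hσ ↦ AlgEquiv.ext fun x ↦ ?_
    refine (forall_mem_adjoin_smul_eq_self_iff L σ).2 ?_ x
      (hsup ▸ IntermediateField.mem_top : x ∈ adjoin L (Set.range (algebraMap K E)))
    rintro _ ⟨x, rfl⟩
    rw [AlgEquiv.smul_def, ← hf, hσ, AlgEquiv.one_apply]
  have hsurj : Function.Surjective f := by
    let H : ClosedSubgroup Gal(K/F) :=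
      ⟨f.range, (isCompact_range hcont).isClosed⟩
    have hH : fixedField H.toSubgroup = ⊥ := by
      refine eq_bot_iff.2 fun x hx ↦ ?_
      rw [mem_fixedField_iff] at hx
      obtain ⟨y, hy⟩ := (InfiniteGalois.mem_range_algebraMap_iff_fixed (k := L)
        (algebraMap K E x)).2 fun σ ↦ by rw [← hf, hx _ ⟨σ, rfl⟩]
      exact mem_bot.2 (hinf x y hy.symm)
    have := InfiniteGalois.fixingSubgroup_fixedField H
    rw [hH, fixingSubgroup_bot] at this
    exact MonoidHom.range_eq_top.1 this.symm
  let e := MulEquiv.ofBijective f ⟨hinj, hsurj⟩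
  exact ⟨e, hcont, (hcont.homeoOfEquivCompactToT2 (f := e.toEquiv)).symm.continuous, hf⟩

end BaseChange

section IntermediateFields

variable {K L : Type*} [Field K] [Field L] [Algebra K L]

theorem minpoly_coe_extendScalars {A B : IntermediateField K L} (h : A ≤ B)
    (x : extendScalars h) : minpoly A x = minpoly A (x : L) :=
  (minpoly.algebraMap_eq (algebraMap (extendScalars h) L).injective x).symm

/-- Elementwise form of `B / A` being Galois, for subfields `A ≤ B` of `L`. -/
def IsGaloisStep (A B : IntermediateField K L) : Prop :=
  ∀ x ∈ B, IsSeparable A x ∧ ((minpoly A x).map (algebraMap A L)).Splits ∧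
    ∀ y : L, aeval y (minpoly A x) = 0 → y ∈ B

theorem isGalois_extendScalars_iff {A B : IntermediateField K L} (h : A ≤ B) :
    IsGalois A (extendScalars h) ↔ IsGaloisStep A B := by
  have hroot {x : L} (hs : IsSeparable A x) (y : L) :
      y ∈ (minpoly A x).rootSet L ↔ aeval y (minpoly A x) = 0 :=
    mem_rootSet_of_ne hs.ne_zero
  rw [isGalois_iff]
  constructor
  · rintro ⟨_, hn⟩ x hx
    have hs : IsSeparable A x := by
      have := Algebra.IsSeparable.isSeparable A (⟨x, hx⟩ : extendScalars h)
      rwa [IsSeparable, minpoly_coe_extendScalars] at this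
    have hspl := hn.splits ⟨x, hx⟩
    rw [minpoly_coe_extendScalars] at hspl
    have hL : ((minpoly A x).map (algebraMap A L)).Splits := by
      have := hspl.map (algebraMap (extendScalars h) L)
      rwa [Polynomial.map_map, ← IsScalarTower.algebraMap_eq] at this
    exact ⟨hs, hL, fun y hy ↦ (splits_iff_mem hL).1 hspl y ((hroot hs y).2 hy)⟩
  · intro H
    refine ⟨⟨fun x ↦ .of_algHom (extendScalars h).val (H x x.2).1⟩, normal_iff.2 fun x ↦ ?_⟩
    obtain ⟨hs, hL, hy⟩ := H x x.2
    refine ⟨(isIntegral_algHom_iff (extendScalars h).val Subtype.val_injective).1 hs.isIntegral,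
      ?_⟩
    rw [minpoly_coe_extendScalars]
    exact (splits_iff_mem hL).2 fun y hy' ↦ hy y ((hroot hs y).1 hy')

namespace IsGaloisStep

variable {A B C M N : IntermediateField K L}

theorem inf (h : IsGaloisStep A B) (h' : IsGaloisStep A C) : IsGaloisStep A (B ⊓ C) :=
  fun x hx ↦ ⟨(h x hx.1).1, (h x hx.1).2.1,
    fun y hy ↦ ⟨(h x hx.1).2.2 y hy, (h' x hx.2).2.2 y hy⟩⟩

theorem of_le_left (h : IsGaloisStep A B) (hAC : A ≤ C) : IsGaloisStep C B := by
  intro x hx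
  let _ : Algebra A C := (inclusion hAC).toRingHom.toAlgebra
  have : IsScalarTower A C L := .of_algebraMap_eq fun _ ↦ rfl
  obtain ⟨hs, hspl, hy⟩ := h x hx
  have hdvd := minpoly.dvd_map_of_isScalarTower A C x
  refine ⟨hs.tower_top C, ?_, fun y h ↦ hy y ?_⟩
  · have := Polynomial.map_dvd (algebraMap C L) hdvd
    rw [Polynomial.map_map, ← IsScalarTower.algebraMap_eq] at this
    exact hspl.of_dvd ((Polynomial.map_ne_zero_iff (algebraMap A L).injective).2 hs.ne_zero) this
  · rw [← aeval_map_algebraMap C]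
    exact aeval_eq_zero_of_dvd_aeval_eq_zero hdvd h

theorem sup_left (h : IsGaloisStep A M) (hAC : A ≤ C) : IsGaloisStep C (C ⊔ M) := by
  have hM := h.of_le_left hAC
  have hle : C ≤ C ⊔ M := le_sup_left
  have hadj : extendScalars hle = adjoin C (M : Set L) := by
    apply restrictScalars_injective K
    rw [restrictScalars_adjoin_eq_sup, extendScalars_restrictScalars, adjoin_self]
  have hL : ∀ x ∈ M, ((minpoly C x).map (algebraMap C (extendScalars hle))).Splits := by
    intro x hx
    refine (splits_iff_mem (hM x hx).2.1).2 fun y hy ↦ ?_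
    exact (le_sup_right : M ≤ C ⊔ M)
      ((hM x hx).2.2 y ((mem_rootSet_of_ne (hM x hx).1.ne_zero).1 hy))
  rw [← isGalois_extendScalars_iff hle, isGalois_iff]
  refine ⟨?_, normal_iff.2 fun x ↦ ?_⟩
  · rw [hadj, isSeparable_adjoin_iff_isSeparable]
    exact fun x hx ↦ (hM x hx).1
  · have hx : (x : L) ∈ adjoin C (M : Set L) := hadj ▸ x.2
    refine ⟨(isIntegral_algHom_iff (extendScalars hle).val Subtype.val_injective).1 ?_, ?_⟩
    · have : Algebra.IsSeparable C (adjoin C (M : Set L)) :=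
        (isSeparable_adjoin_iff_isSeparable C L).2 fun y hy ↦ (hM y hy).1
      exact ((Algebra.IsSeparable.isSeparable C (⟨x, hx⟩ : adjoin C (M : Set L))).map
        (f := (adjoin C (M : Set L)).val) Subtype.val_injective).isIntegral
    rw [minpoly_coe_extendScalars]
    exact splits_of_mem_adjoin C L (fun y hy ↦ ⟨(hM y hy).1.isIntegral, hL y hy⟩) hx

theorem inf_of_sup (hM : IsGaloisStep A M) (hN : IsGaloisStep C N) (hAC : A ≤ C) (hAM : A ≤ M) :
    IsGaloisStep (M ⊓ C) (M ⊓ N) := by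
  intro x ⟨hxM, hxN⟩
  obtain ⟨hs, hspl, hroot⟩ := hM.of_le_left (le_inf hAM hAC) x hxM
  let _ : Algebra ↥(M ⊓ C) C := (inclusion inf_le_right).toRingHom.toAlgebra
  have : IsScalarTower ↥(M ⊓ C) C L := .of_algebraMap_eq fun _ ↦ rfl
  obtain ⟨hsC, hsplC, hrootC⟩ := hM.of_le_left hAC x hxM
  have hmon : (minpoly C x).Monic := minpoly.monic hsC.isIntegral
  have hlift : (minpoly C x).map (algebraMap C L) ∈ lifts (algebraMap M L) := by
    refine hsplC.mem_lift_of_roots_mem_range (hmon.map _) _ fun y hy ↦ ?_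
    refine ⟨⟨y, hrootC y ?_⟩, rfl⟩
    rw [← eval_map_algebraMap]
    exact (mem_roots'.1 hy).2
  have hliftC : minpoly C x ∈ lifts (algebraMap ↥(M ⊓ C) C) := by
    rw [lifts_iff_coeff_lifts] at hlift ⊢
    intro n
    obtain ⟨z, hz⟩ := hlift n
    rw [coeff_map] at hz
    change (z : L) = ((minpoly C x).coeff n : L) at hz
    exact ⟨⟨(minpoly C x).coeff n, hz ▸ z.2, ((minpoly C x).coeff n).2⟩, rfl⟩
  obtain ⟨q, hq⟩ := (mem_lifts _).1 hliftC
  refine ⟨hs, hspl, fun y hy ↦ ⟨hroot y hy, (hN x hxN).2.2 y ?_⟩⟩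
  rw [← hq, aeval_map_algebraMap]
  refine aeval_eq_zero_of_dvd_aeval_eq_zero (minpoly.dvd _ _ ?_) hy
  rw [← aeval_map_algebraMap C, hq, minpoly.aeval]

theorem exists_baseChange_equiv (hB : IsGaloisStep A B) (hN : IsGaloisStep C N)
    (hAB : A ≤ B) (hCN : C ≤ N) (hAC : A ≤ C) (hBN : B ≤ N) (hinf : B ⊓ C ≤ A)
    (hsup : N ≤ B ⊔ C) :
    ∃ e : Gal(extendScalars hCN/C) ≃* Gal(extendScalars hAB/A),
      Continuous e ∧ Continuous e.symm ∧ ∀ σ (x : L) (hx : x ∈ B),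
        (e σ ⟨x, hx⟩ : L) = (σ ⟨x, hBN hx⟩ : L) := by
  have : IsGalois A (extendScalars hAB) := (isGalois_extendScalars_iff hAB).2 hB
  have : IsGalois C (extendScalars hCN) := (isGalois_extendScalars_iff hCN).2 hN
  let i : extendScalars hAB →+* extendScalars hCN := (inclusion hBN).toRingHom
  let _ : Algebra A C := (inclusion hAC).toRingHom.toAlgebra
  let _ : Algebra A (extendScalars hCN) := (inclusion (hAC.trans hCN)).toRingHom.toAlgebra
  let _ : Algebra (extendScalars hAB) (extendScalars hCN) := i.toAlgebra
  have : IsScalarTower A C (extendScalars hCN) := .of_algebraMap_eq fun _ ↦ rfl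
  have : IsScalarTower A (extendScalars hAB) (extendScalars hCN) :=
    .of_algebraMap_eq fun _ ↦ rfl
  have htop : adjoin C (Set.range (algebraMap (extendScalars hAB) (extendScalars hCN))) = ⊤ := by
    set T := adjoin C (Set.range (algebraMap (extendScalars hAB) (extendScalars hCN)))
    have hle : B ⊔ C ≤ (lift T).restrictScalars K := by
      refine sup_le (fun x hx ↦ ?_) fun x hx ↦ (lift T).algebraMap_mem ⟨x, hx⟩
      exact (mem_lift (⟨x, hBN hx⟩ : extendScalars hCN)).2 (subset_adjoin C _ ⟨⟨x, hx⟩, rfl⟩)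
    exact eq_top_iff.2 fun x _ ↦ (mem_lift x).1 (hle (hsup x.2))
  obtain ⟨e, he, he', h⟩ := exists_galois_baseChange_equiv A (extendScalars hAB) C
    (extendScalars hCN) (fun x y hxy ↦ by
      have hxy' : (x : L) = y := congr_arg Subtype.val hxy
      exact ⟨⟨x, hinf ⟨x.2, hxy' ▸ y.2⟩⟩, rfl⟩) htop
  exact ⟨e, he, he', fun σ x hx ↦ congr_arg Subtype.val (h σ ⟨x, hx⟩)⟩

theorem inf_sup_eq (hM : IsGaloisStep A M) (hAC : A ≤ C) (hAM : A ≤ M) (hCN : C ≤ N)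
    (hNM : N ≤ M ⊔ C) : M ⊓ N ⊔ C = N := by
  have hle : M ⊓ N ⊔ C ≤ N := sup_le inf_le_right hCN
  refine le_antisymm hle fun x hx ↦ ?_
  have hN' : M ⊓ N ⊔ C ≤ M ⊔ C := hle.trans hNM
  have hM0 : IsGaloisStep (M ⊓ N) M := hM.of_le_left (le_inf hAM (hAC.trans hCN))
  have htop : IsGaloisStep (M ⊓ N ⊔ C) (M ⊔ C) := by
    simpa only [sup_comm C M] using (hM.sup_left hAC).of_le_left le_sup_right
  obtain ⟨e, -, -, he⟩ := hM0.exists_baseChange_equiv htop inf_le_left hN' le_sup_left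
    le_sup_left (inf_le_inf_left M hle) (sup_le le_sup_left (le_sup_right.trans le_sup_right))
  obtain ⟨e', -, -, he'⟩ := hM0.exists_baseChange_equiv (htop.of_le_left hle) inf_le_left hNM
    inf_le_right le_sup_left le_rfl (sup_le le_sup_left (hCN.trans le_sup_right))
  have : IsGalois ↥(M ⊓ N ⊔ C) (extendScalars hN') := (isGalois_extendScalars_iff hN').2 htop
  obtain ⟨y, hy⟩ := (InfiniteGalois.mem_range_algebraMap_iff_fixed (k := ↥(M ⊓ N ⊔ C))
    (⟨x, hNM hx⟩ : extendScalars hN')).2 fun σ ↦ by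
      let τ := e'.symm (e σ)
      let τ' : Gal(extendScalars hN'/↥(M ⊓ N ⊔ C)) :=
        { τ.toRingEquiv with commutes' := fun z ↦ τ.commutes ⟨z, hle z.2⟩ }
      have hτ : τ' = σ := e.injective <| AlgEquiv.ext fun z ↦ Subtype.ext <| by
        rw [he τ' z z.2, ← e'.apply_symm_apply (e σ), he' _ z z.2]
        rfl
      rw [← hτ]
      exact τ.commutes ⟨x, hx⟩
  have hyx : (y : L) = x := congr_arg Subtype.val hy
  exact hyx ▸ y.2

end IsGaloisStep

/-- The Galois groups of `B / A` and `D / C` are isomorphic as topological groups. -/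
def GaloisGroupEquiv (A B C D : IntermediateField K L) : Prop :=
  ∀ (hAB : A ≤ B) (hCD : C ≤ D),
    ∃ e : Gal(extendScalars hAB/A) ≃* Gal(extendScalars hCD/C), Continuous e ∧ Continuous e.symm

namespace GaloisGroupEquiv

variable {A B C D F G : IntermediateField K L}

theorem symm (h : GaloisGroupEquiv A B C D) : GaloisGroupEquiv C D A B := fun hCD hAB ↦
  let ⟨e, he, he'⟩ := h hAB hCD
  ⟨e.symm, he', he⟩

theorem trans (h : GaloisGroupEquiv A B C D) (hCD : C ≤ D) (h' : GaloisGroupEquiv C D F G) :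
    GaloisGroupEquiv A B F G := fun hAB hFG ↦
  let ⟨e, he, he'⟩ := h hAB hCD
  let ⟨f, hf, hf'⟩ := h' hCD hFG
  ⟨e.trans f, hf.comp he, he'.comp hf'⟩

end GaloisGroupEquiv

theorem IsGaloisStep.galoisGroupEquiv_inf {A C M N : IntermediateField K L}
    (hM : IsGaloisStep A M) (hN : IsGaloisStep C N) (hAM : A ≤ M) (hAC : A ≤ C) (hCN : C ≤ N)
    (hNM : N ≤ M ⊔ C) : GaloisGroupEquiv (M ⊓ C) (M ⊓ N) C N := by
  refine .symm fun _ h ↦ ?_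
  obtain ⟨e, he, he', -⟩ := (hM.inf_of_sup hN hAC hAM).exists_baseChange_equiv hN h hCN
    inf_le_right inf_le_right (inf_le_inf_right C inf_le_left)
    (hM.inf_sup_eq hAC hAM hCN hNM).ge
  exact ⟨e, he, he'⟩

section Butterfly

variable {A B C D : IntermediateField K L}

theorem IsGaloisStep.butterfly (hAB : IsGaloisStep A B) (hCD : IsGaloisStep C D)
    (hA : A ≤ B) (hC : C ≤ D) : IsGaloisStep (B ⊓ (A ⊔ C)) (B ⊓ (A ⊔ D)) := by
  have h : IsGaloisStep (A ⊔ C) (A ⊔ D) := by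
    have := hCD.sup_left (le_sup_right : C ≤ A ⊔ C)
    rwa [sup_assoc, sup_eq_right.2 hC] at this
  exact hAB.inf_of_sup h le_sup_left hA

/-- Field-theoretic analogue of the butterfly lemma. -/
theorem IsGaloisStep.galoisGroupEquiv_butterfly (hAB : IsGaloisStep A B) (hCD : IsGaloisStep C D)
    (hA : A ≤ B) (hC : C ≤ D) :
    GaloisGroupEquiv (B ⊓ (A ⊔ C)) (B ⊓ (A ⊔ D)) (D ⊓ (C ⊔ A)) (D ⊓ (C ⊔ B)) := by
  have hD : IsGaloisStep (A ⊔ C) (A ⊔ D) := by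
    have := hCD.sup_left (le_sup_right : C ≤ A ⊔ C)
    rwa [sup_assoc, sup_eq_right.2 hC] at this
  have hB : IsGaloisStep (A ⊔ C) (C ⊔ B) := by
    have := hAB.sup_left (le_sup_right : A ≤ C ⊔ A)
    rwa [sup_assoc, sup_eq_right.2 hA, sup_comm C A] at this
  have hle : A ⊔ C ≤ (A ⊔ D) ⊓ (C ⊔ B) :=
    le_inf (sup_le_sup_left hC A) (sup_le (hA.trans le_sup_right) le_sup_left)
  have h₁ := hAB.galoisGroupEquiv_inf (hD.inf hB) hA le_sup_left hle
    (inf_le_right.trans (sup_le (le_sup_right.trans le_sup_right) le_sup_left))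
  have h₂ := hCD.galoisGroupEquiv_inf (hD.inf hB) hC le_sup_right hle
    (inf_le_left.trans (sup_le (le_sup_left.trans le_sup_right) le_sup_left))
  have e₁ : B ⊓ ((A ⊔ D) ⊓ (C ⊔ B)) = B ⊓ (A ⊔ D) := by
    rw [inf_left_comm, inf_eq_left.2 (le_sup_right : B ≤ C ⊔ B), inf_comm]
  have e₂ : D ⊓ ((A ⊔ D) ⊓ (C ⊔ B)) = D ⊓ (C ⊔ B) := by
    rw [← inf_assoc, inf_eq_left.2 (le_sup_right : D ≤ A ⊔ D)]
  rw [e₁] at h₁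
  rw [e₂, sup_comm A C] at h₂
  rw [sup_comm A C] at h₁ hle ⊢
  exact h₁.trans hle h₂.symm

end Butterfly

section Tower

/-- The fields of a tower, continued constantly after its last step. -/
def extendTower {m : ℕ} (F : Fin (m + 1) → IntermediateField K L) (i : ℕ) :
    IntermediateField K L :=
  F ⟨min i m, by omega⟩

variable {m n : ℕ} {F : Fin (m + 1) → IntermediateField K L}
  {E : Fin (n + 1) → IntermediateField K L}

theorem extendTower_val (F : Fin (m + 1) → IntermediateField K L) (i : Fin (m + 1)) :
    extendTower F i = F i :=
  congr_arg F (Fin.ext (min_eq_left (Nat.le_of_lt_succ i.2)))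

theorem IsGaloisTower.monotone_extendTower (h : IsGaloisTower F) : Monotone (extendTower F) :=
  fun _ _ hij ↦ h.1 (Fin.mk_le_mk.2 (min_le_min_right m hij))

theorem IsGaloisTower.extendTower_zero (h : IsGaloisTower F) : extendTower F 0 = ⊥ :=
  (extendTower_val F 0).trans h.2.1

theorem IsGaloisTower.extendTower_succ (h : IsGaloisTower F) : extendTower F (m + 1) = ⊤ := by
  rw [← h.2.2.1]
  exact congr_arg F (Fin.ext (min_eq_right m.le_succ))

theorem isGaloisStep_self (A : IntermediateField K L) : IsGaloisStep A A := by
  rw [← isGalois_extendScalars_iff le_rfl, extendScalars_self]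
  infer_instance

theorem IsGaloisTower.isGaloisStep_extendTower (h : IsGaloisTower F) (i : ℕ) :
    IsGaloisStep (extendTower F i) (extendTower F (i + 1)) := by
  rcases lt_or_ge i m with hi | hi
  · have hle : F (Fin.castSucc ⟨i, hi⟩) ≤ F (Fin.succ ⟨i, hi⟩) := h.1 (Fin.castSucc_le_succ _)
    have := (isGalois_extendScalars_iff hle).1 (h.2.2.2 ⟨i, hi⟩ hle)
    rw [← extendTower_val F, ← extendTower_val F] at this
    exact this
  · have : extendTower F (i + 1) = extendTower F i :=
      congr_arg F (Fin.ext (by simp only; omega))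
    rw [this]
    exact isGaloisStep_self _

/-- The Schreier refinement of the tower `F` by the tower `E`: between `F i` and `F (i + 1)` the
fields `F (i + 1) ⊓ (F i ⊔ E j)` are inserted. -/
def schreierRefinement (F : Fin (m + 1) → IntermediateField K L)
    (E : Fin (n + 1) → IntermediateField K L) (k : Fin ((m + 1) * (n + 1) + 1)) :
    IntermediateField K L :=
  extendTower F (k / (n + 1) + 1) ⊓ (extendTower F (k / (n + 1)) ⊔ extendTower E (k % (n + 1)))

theorem schreierRefinement_castSucc (F : Fin (m + 1) → IntermediateField K L)
    (E : Fin (n + 1) → IntermediateField K L) (k : Fin ((m + 1) * (n + 1))) :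
    schreierRefinement F E k.castSucc = extendTower F (k.divNat + 1) ⊓
      (extendTower F k.divNat ⊔ extendTower E k.modNat) := rfl

theorem schreierRefinement_of_eq_mul (hF : IsGaloisTower F) (hE : IsGaloisTower E)
    {k : Fin ((m + 1) * (n + 1) + 1)} {i : ℕ} (hk : (k : ℕ) = i * (n + 1)) :
    schreierRefinement F E k = extendTower F i := by
  rw [schreierRefinement, hk, Nat.mul_div_cancel _ n.succ_pos, Nat.mul_mod_left,
    hE.extendTower_zero, sup_bot_eq]
  exact inf_eq_right.2 (hF.monotone_extendTower i.le_succ)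

theorem schreierRefinement_succ (hF : IsGaloisTower F) (hE : IsGaloisTower E)
    (k : Fin ((m + 1) * (n + 1))) :
    schreierRefinement F E k.succ = extendTower F (k.divNat + 1) ⊓
      (extendTower F k.divNat ⊔ extendTower E (k.modNat + 1)) := by
  have hdiv : ((k : ℕ) + 1 : ℕ) = k.divNat * (n + 1) + (k.modNat + 1) := by
    rw [← add_assoc, Fin.coe_divNat, Fin.coe_modNat, Nat.div_add_mod']
  rcases eq_or_lt_of_le (Nat.lt_succ_iff.1 k.modNat.2) with h | h
  · have hk : ((k.succ : Fin _) : ℕ) = (k.divNat + 1) * (n + 1) := by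
      rw [Fin.val_succ, hdiv, h, add_one_mul]
    rw [schreierRefinement_of_eq_mul hF hE hk, h, hE.extendTower_succ, sup_top_eq, inf_top_eq]
  · have h' : (k.modNat : ℕ) + 1 < n + 1 := Nat.succ_lt_succ h
    rw [schreierRefinement, Fin.val_succ, hdiv, mul_comm, Nat.mul_add_div n.succ_pos,
      Nat.div_eq_of_lt h', add_zero, Nat.mul_add_mod, Nat.mod_eq_of_lt h']

theorem isGaloisTower_schreierRefinement (hF : IsGaloisTower F) (hE : IsGaloisTower E) :
    IsGaloisTower (schreierRefinement F E) := by
  refine ⟨Fin.monotone_iff_le_succ.2 fun k ↦ ?_, ?_, ?_, fun k h ↦ ?_⟩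
  · rw [schreierRefinement_castSucc, schreierRefinement_succ hF hE]
    exact inf_le_inf_left _ (sup_le_sup_left (hE.monotone_extendTower (Nat.le_succ _)) _)
  · rw [schreierRefinement_of_eq_mul hF hE (i := 0) (by simp), hF.extendTower_zero]
  · rw [schreierRefinement_of_eq_mul hF hE (i := m + 1) rfl, hF.extendTower_succ]
  · rw [isGalois_extendScalars_iff, schreierRefinement_castSucc, schreierRefinement_succ hF hE]
    exact (hF.isGaloisStep_extendTower _).butterfly (hE.isGaloisStep_extendTower _)
      (hF.monotone_extendTower (Nat.le_succ _)) (hE.monotone_extendTower (Nat.le_succ _))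

theorem refines_schreierRefinement (hF : IsGaloisTower F) (hE : IsGaloisTower E) :
    Refines (schreierRefinement F E) F := by
  refine ⟨fun i ↦ ⟨i * (n + 1), Nat.lt_succ_of_le (Nat.mul_le_mul_right _ i.2.le)⟩,
    fun i j hij ↦ Fin.mk_lt_mk.2 (Nat.mul_lt_mul_of_pos_right hij n.succ_pos), fun i ↦ ?_⟩
  rw [schreierRefinement_of_eq_mul hF hE rfl, extendTower_val]

theorem towerEquiv_schreierRefinement (hF : IsGaloisTower F) (hE : IsGaloisTower E) :
    TowerEquiv (schreierRefinement F E) (schreierRefinement E F) := by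
  let σ : Fin ((m + 1) * (n + 1)) ≃ Fin ((n + 1) * (m + 1)) :=
    finProdFinEquiv.symm.trans ((Equiv.prodComm _ _).trans finProdFinEquiv)
  refine ⟨σ, fun k ↦ ?_⟩
  have hσ : finProdFinEquiv.symm (σ k) = (k.modNat, k.divNat) := Equiv.symm_apply_apply _ _
  have hdiv : (σ k).divNat = k.modNat := congr_arg Prod.fst hσ
  have hmod : (σ k).modNat = k.divNat := congr_arg Prod.snd hσ
  change GaloisGroupEquiv (schreierRefinement F E k.castSucc) (schreierRefinement F E k.succ)
    (schreierRefinement E F (σ k).castSucc) (schreierRefinement E F (σ k).succ)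
  rw [schreierRefinement_castSucc, schreierRefinement_succ hF hE, schreierRefinement_castSucc,
    schreierRefinement_succ hE hF, hdiv, hmod]
  exact (hF.isGaloisStep_extendTower _).galoisGroupEquiv_butterfly (hE.isGaloisStep_extendTower _)
    (hF.monotone_extendTower (Nat.le_succ _)) (hE.monotone_extendTower (Nat.le_succ _))

end Tower

end IntermediateFields

end GaloisTowers

/-- First dissociation theorem ("Galschreier"): two Galois towers of a same galtourable
extension (of arbitrary degree) admit refinements which are equivalent Galois towers. -/
theorem galschreier (K L : Type*) [Field K] [Field L] [Algebra K L]
    (hgal : Galtourable K L) {m n : ℕ}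
    (T₁ : Fin (m + 1) → IntermediateField K L)
    (T₂ : Fin (n + 1) → IntermediateField K L)
    (h₁ : IsGaloisTower T₁) (h₂ : IsGaloisTower T₂) :
    ∃ (p q : ℕ) (T₁' : Fin (p + 1) → IntermediateField K L)
      (T₂' : Fin (q + 1) → IntermediateField K L),
      IsGaloisTower T₁' ∧ IsGaloisTower T₂' ∧
      Refines T₁' T₁ ∧ Refines T₂' T₂ ∧ TowerEquiv T₁' T₂' :=
  ⟨_, _, schreierRefinement T₁ T₂, schreierRefinement T₂ T₁,
    isGaloisTower_schreierRefinement h₁ h₂, isGaloisTower_schreierRefinement h₂ h₁,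
    refines_schreierRefinement h₁ h₂, refines_schreierRefinement h₂ h₁,
    towerEquiv_schreierRefinement h₁ h₂⟩
end

section
/- For every tower of fields F_0 ≤ F_1 ≤ F_2, if the extensions F_1/F_0 and F_2/F_1 are both galsimple and not Galois, then the extension F_2/F_0 is galsimple and not Galois. -/
/-- An extension `L/K` is galsimple if it is nontrivial and admits no proper nontrivial
Galois quotient extension: `L ≠ K`, and every intermediate field `F` with `F/K` Galois
satisfies `F = K` or `F = L`. -/
def Galsimple (K L : Type*) [Field K] [Field L] [Algebra K L] : Prop :=
  (⊥ : IntermediateField K L) ≠ ⊤ ∧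
    ∀ F : IntermediateField K L, IsGalois K F → F = ⊥ ∨ F = ⊤

open IntermediateField Polynomial in
/-- Base change of Galois extensions: if `E/K` is Galois inside `M` and `K ≤ L ≤ M`, then
the compositum `L(E)/L` is Galois. -/
theorem IntermediateField.isGalois_adjoin_of_isGalois {K L M : Type*} [Field K] [Field L]
    [Field M] [Algebra K L] [Algebra L M] [Algebra K M] [IsScalarTower K L M]
    (E : IntermediateField K M) [IsGalois K E] : IsGalois L (adjoin L (E : Set M)) := by
  have hint : ∀ x ∈ (E : Set M), IsIntegral K x := fun x hx ↦
    isIntegral_iff.mp (Algebra.IsIntegral.isIntegral (R := K) (⟨x, hx⟩ : E))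
  have hsep : Algebra.IsSeparable L (adjoin L (E : Set M)) := by
    refine (isSeparable_adjoin_iff_isSeparable L M).mpr fun x hx ↦ ?_
    have h : IsSeparable K x := by
      have := Algebra.IsSeparable.isSeparable K (⟨x, hx⟩ : E)
      rwa [IsSeparable, minpoly_eq] at this
    exact h.tower_top L
  refine isGalois_iff.mpr
    ⟨hsep, normal_iff.mpr fun y ↦ ⟨Algebra.IsIntegral.isIntegral y, ?_⟩⟩
  rw [minpoly_eq]
  refine splits_of_mem_adjoin L M (S := (E : Set M)) (fun x hx ↦ ⟨(hint x hx).tower_top, ?_⟩) y.2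
  have hle : E ≤ (adjoin L (E : Set M)).restrictScalars K := fun z hz ↦ subset_adjoin L _ hz
  have hspl := (Normal.splits (F := K) (K := E) inferInstance ⟨x, hx⟩).map
    (inclusion hle).toRingHom
  rw [minpoly_eq, Polynomial.map_map] at hspl
  refine Splits.of_dvd (g := ((minpoly K x).map (algebraMap K L)).map (algebraMap L _)) ?_ ?_
    (Polynomial.map_dvd _ (minpoly.dvd_map_of_isScalarTower K L x))
  · rw [Polynomial.map_map]
    convert! hspl using 2
    ext z
    exact (IsScalarTower.algebraMap_apply K L M z).symm
  · exact Polynomial.map_ne_zero (Polynomial.map_ne_zero (minpoly.ne_zero (hint x hx)))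

theorem Galsimple.eq_bot_of_isGalois {K L : Type*} [Field K] [Field L] [Algebra K L]
    (h : Galsimple K L) (h' : ¬ IsGalois K L) (F : IntermediateField K L) [IsGalois K F] :
    F = ⊥ := by
  refine (h.2 F inferInstance).resolve_right ?_
  rintro rfl
  exact h' (isGalois_iff_isGalois_top.mp inferInstance)

/-- Transitivity of non-Galois galsimplicity: for a tower of fields `F₀ ≤ F₁ ≤ F₂`, if
`F₁/F₀` and `F₂/F₁` are both galsimple and not Galois, then so is `F₂/F₀`. -/
theorem galsimple_not_galois_trans (F₀ F₁ F₂ : Type*) [Field F₀] [Field F₁] [Field F₂]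
    [Algebra F₀ F₁] [Algebra F₁ F₂] [Algebra F₀ F₂] [IsScalarTower F₀ F₁ F₂]
    (h₁ : Galsimple F₀ F₁) (h₁' : ¬ IsGalois F₀ F₁)
    (h₂ : Galsimple F₁ F₂) (h₂' : ¬ IsGalois F₁ F₂) :
    Galsimple F₀ F₂ ∧ ¬ IsGalois F₀ F₂ := by
  have hgal : ¬ IsGalois F₀ F₂ := fun _ ↦ h₂' (IsGalois.tower_top_of_isGalois F₀ F₁ F₂)
  refine ⟨⟨fun h ↦ hgal (isGalois_iff_isGalois_top.mp (h ▸ isGalois_bot)), fun E _ ↦ Or.inl ?_⟩,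
    hgal⟩
  have := E.isGalois_adjoin_of_isGalois (L := F₁)
  have hadj := h₂.eq_bot_of_isGalois h₂' (IntermediateField.adjoin F₁ (E : Set F₂))
  let f := IsScalarTower.toAlgHom F₀ F₁ F₂
  have hmap : (E.comap f).map f = E := by
    refine le_antisymm (IntermediateField.map_le_iff_le_comap.mpr le_rfl) fun x hx ↦ ?_
    have hx' := IntermediateField.subset_adjoin F₁ (E : Set F₂) hx
    rw [hadj] at hx'
    obtain ⟨y, rfl⟩ := IntermediateField.mem_bot.mp hx'
    exact ⟨y, hx, rfl⟩
  have : IsGalois F₀ (E.comap f) :=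
    IsGalois.of_algEquiv
      ((IntermediateField.equivOfEq hmap.symm).trans ((E.comap f).equivMap f).symm)
  rw [← hmap, h₁.eq_bot_of_isGalois h₁' (E.comap f), IntermediateField.map_bot]
end

section
/- For every integer n ≥ 3 and every complex number θ satisfying θ^n − θ − 1 = 0, the extension ℚ(θ)/ℚ is simple but not Galois: ℚ(θ) ≠ ℚ, the only intermediate fields F with ℚ ≤ F ≤ ℚ(θ) are F = ℚ and F = ℚ(θ), and ℚ(θ)/ℚ is not a normal extension. -/
open Polynomial NumberField IntermediateField MulAction

theorem NumberField.iSup_inertia_eq_top (L G : Type*) [Field L] [NumberField L] [Group G]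
    [MulSemiringAction G L] [IsGaloisGroup G ℚ L] :
    ⨆ m : MaximalSpectrum (𝓞 L), m.asIdeal.inertia G = ⊤ := by
  have : Finite G := IsGaloisGroup.finite G ℚ L
  obtain ⟨H, hH⟩ : ∃ H : Subgroup G, H = ⨆ m : MaximalSpectrum (𝓞 L), m.asIdeal.inertia G :=
    ⟨_, rfl⟩
  obtain ⟨K, hHK⟩ : ∃ K : IntermediateField ℚ L, K = FixedPoints.intermediateField H := ⟨_, rfl⟩
  have : IsGaloisGroup H K L := IsGaloisGroup.of_fixedPoints_eq G ℚ L H K hHK.symm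
  have : IsGaloisGroup H (𝓞 K) (𝓞 L) := .of_isFractionRing H (𝓞 K) (𝓞 L) K L
  have hK : Module.finrank ℚ K = 1 := by
    by_contra hne
    obtain ⟨p, hp, hram⟩ := NumberField.exists_not_isUnramifiedAt_int (𝒪 := 𝓞 K) hne
    apply hram
    obtain ⟨P, hPmax, hPp⟩ := Ideal.exists_maximal_ideal_liesOver_of_isIntegral (S := 𝓞 L) p
    have : P.LiesOver (p.under ℤ) := .trans P p _
    have hP : P.inertia G ≤ H :=
      hH ▸ le_iSup (fun m : MaximalSpectrum (𝓞 L) ↦ m.asIdeal.inertia G) ⟨P, hPmax⟩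
    have : Finite (𝓞 K ⧸ p) :=
      Ideal.finiteQuotientOfFreeOfNeBot p (Ideal.IsMaximal.ne_bot_of_isIntegral_int p)
    have : Finite (ℤ ⧸ p.under ℤ) :=
      Ideal.finiteQuotientOfFreeOfNeBot _
        (Ideal.IsMaximal.ne_bot_of_isIntegral_int (p.under ℤ))
    have hPG : Nat.card (P.inertia G) = P.ramificationIdx ℤ := by
      rw [Ideal.card_inertia_eq_ramificationIdxIn (p.under ℤ) P,
        Ideal.ramificationIdxIn_eq_ramificationIdx (p.under ℤ) P G]
    have hPH : Nat.card (P.inertia H) = P.ramificationIdx (𝓞 K) := by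
      rw [Ideal.card_inertia_eq_ramificationIdxIn p P,
        Ideal.ramificationIdxIn_eq_ramificationIdx p P H]
    have hGH : Nat.card (P.inertia H) = Nat.card (P.inertia G) :=
      Nat.card_congr (Subgroup.subgroupOfEquivOfLe hP).toEquiv
    have h5 : 0 < P.ramificationIdx ℤ := hPG ▸ Nat.card_pos
    rw [← Ideal.ramificationIdx_eq_one_iff]
    have := Ideal.ramificationIdx_tower (R := ℤ) p P
    have h6 : P.ramificationIdx ℤ = P.ramificationIdx (𝓞 K) := by rw [← hPG, ← hPH, hGH]
    rw [h6] at this h5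
    exact (Nat.mul_eq_right h5.ne').mp this.symm
  rw [← hH, ← IsGaloisGroup.fixingSubgroup_fixedPoints G ℚ L H, ← hHK,
    IntermediateField.finrank_eq_one_iff.mp hK, IsGaloisGroup.fixingSubgroup_bot]

theorem Polynomial.natDegree_X_pow_sub_X_sub_one (R : Type*) [CommRing R] [Nontrivial R] {n : ℕ}
    (hn : 2 ≤ n) : (X ^ n - X - 1 : R[X]).natDegree = n := by
  rw [sub_sub, natDegree_sub_eq_left_of_natDegree_lt, natDegree_X_pow]
  rw [natDegree_X_pow, ← C_1, natDegree_X_add_C]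
  omega

theorem Polynomial.monic_X_pow_sub_X_sub_one (R : Type*) [CommRing R] [Nontrivial R] {n : ℕ}
    (hn : 2 ≤ n) : (X ^ n - X - 1 : R[X]).Monic := by
  rw [sub_sub]
  apply monic_X_pow_sub
  rw [← C_1, degree_X_add_C]
  exact_mod_cast hn

theorem Polynomial.mem_rootSet_X_pow_sub_X_sub_one {R A : Type*} [CommRing R] [Nontrivial R]
    [CommRing A] [IsDomain A] [Algebra R A] {n : ℕ} (hn : 2 ≤ n) {x : A} :
    x ∈ (X ^ n - X - 1 : R[X]).rootSet A ↔ x ^ n - x - 1 = 0 := by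
  rw [(monic_X_pow_sub_X_sub_one R hn).mem_rootSet]
  simp

theorem Polynomial.le_ncard_rootSet_X_pow_sub_X_sub_one_add_one {k : Type*} [Field k]
    {n : ℕ} (hn : 3 ≤ n)
    (hs : ((X ^ n - X - 1 : ℤ[X]).map (algebraMap ℤ k)).Splits) :
    n ≤ ((X ^ n - X - 1 : ℤ[X]).rootSet k).ncard + 1 := by
  classical
  rw [rootSet_def, Set.ncard_coe_finset, aroots_def]
  have hmap : (X ^ n - X - 1 : ℤ[X]).map (algebraMap ℤ k) = X ^ n - X - 1 := by simp
  rw [hmap] at hs ⊢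
  have hdeg : (X ^ n - X - 1 : k[X]).natDegree = n :=
    natDegree_X_pow_sub_X_sub_one k (by omega)
  set f : k[X] := X ^ n - X - 1
  have hf0 : f ≠ 0 := by rintro h; simp [h] at hdeg; omega
  have hder (a : k) (h : 1 < f.roots.count a) : a ^ n = a + 1 ∧ (n : k) * a ^ (n - 1) = 1 := by
    rw [count_roots, one_lt_rootMultiplicity_iff_isRoot hf0] at h
    simp only [f, IsRoot, eval_sub, eval_pow, eval_X, eval_one, derivative_sub, derivative_X_pow,
      eval_mul, eval_C, derivative_X, derivative_one, sub_zero] at h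
    exact ⟨by linear_combination h.1, by linear_combination h.2⟩
  have hmul (a : k) (h : 1 < f.roots.count a) : (n - 1 : k) * a = - n := by
    obtain ⟨h1, h2⟩ := hder a h
    have : a * a ^ (n - 1) = a ^ n := by rw [← pow_succ', Nat.sub_add_cancel (by omega)]
    linear_combination - n * h1 + a * h2 - n * this
  have hn1 (a : k) (h : 1 < f.roots.count a) : (n - 1 : k) ≠ 0 := by
    intro h0
    have := hmul a h
    rw [h0] at this
    have : (1 : k) = 0 := by linear_combination this - h0
    exact one_ne_zero this
  have hle2 (a : k) : f.roots.count a ≤ 2 := by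
    by_contra! h
    have h1 : 1 < f.roots.count a := by omega
    rw [count_roots] at h
    have h2 := isRoot_iterate_derivative_of_lt_rootMultiplicity h
    obtain ⟨-, h3⟩ := hder a h1
    have := hn1 a h1
    simp only [f, IsRoot, eval_pow, eval_X, derivative_sub, derivative_X_pow, eval_mul,
      eval_C, derivative_X, derivative_one, sub_zero, Function.iterate_succ_apply,
      Function.iterate_zero_apply, derivative_C_mul, mul_eq_zero] at h2
    have h4 : a ^ (n - 1) = a * a ^ (n - 1 - 1) := by
      rw [← pow_succ', Nat.sub_add_cancel (by omega)]
    rw [Nat.cast_sub (by omega), Nat.cast_one] at h2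
    rcases h2 with h2 | h2 | h2
    · simp [h2] at h3
    · exact hn1 a h1 h2
    · simp [h4, h2] at h3
  obtain ⟨x, hx⟩ : ∃ x, (f.roots.erase x).Nodup := by
    by_cases h : f.roots.Nodup
    · exact ⟨0, h.erase _⟩
    · simp only [Multiset.nodup_iff_count_le_one, not_forall, not_le] at h
      obtain ⟨x, hx⟩ := h
      refine ⟨x, Multiset.nodup_iff_count_le_one.mpr fun y ↦ ?_⟩
      rcases eq_or_ne y x with rfl | hy
      · have := hle2 y
        rw [Multiset.count_erase_self]; omega
      · rw [Multiset.count_erase_of_ne hy]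
        by_contra! h
        exact hy (mul_left_cancel₀ (hn1 x hx) ((hmul y h).trans (hmul x hx).symm))
  have hcard : f.roots.card = n := by rw [← hs.natDegree_eq_card_roots, hdeg]
  calc n ≤ (f.roots.erase x).card + 1 := by
        have := Multiset.card_le_card (Multiset.le_cons_erase f.roots x)
        simpa [hcard] using this
    _ ≤ _ := by
        rw [← Multiset.toFinset_card_of_nodup hx]
        gcongr
        exact Multiset.toFinset_subset.mpr (Multiset.erase_subset _ _)

theorem minpoly_eq_X_pow_sub_X_sub_one {n : ℕ} (hn : 2 ≤ n) {L : Type*} [Field L] [Algebra ℚ L]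
    {x : L} (hx : x ^ n - x - 1 = 0) : minpoly ℚ x = X ^ n - X - 1 :=
  (minpoly.eq_of_irreducible_of_monic (X_pow_sub_X_sub_one_irreducible_rat (by omega))
    (by simpa using hx) (monic_X_pow_sub_X_sub_one ℚ hn)).symm

theorem X_pow_sub_X_sub_one_surjective_toPermHom {n : ℕ} (hn : 3 ≤ n) {L : Type*} [Field L]
    [NumberField L] [IsGalois ℚ L] (hs : ((X ^ n - X - 1 : ℚ[X]).map (algebraMap ℚ L)).Splits) :
    Function.Surjective
      (MulAction.toPermHom Gal(L/ℚ) ((X ^ n - X - 1 : ℤ[X]).rootSet (𝓞 L))) := by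
  have hS : ((X ^ n - X - 1 : ℤ[X]).map (algebraMap ℤ (𝓞 L))).Splits := by
    refine Splits.of_splits_map_of_injective (i := algebraMap (𝓞 L) L)
      RingOfIntegers.coe_injective (by simpa using hs) fun x hx ↦ ?_
    have hx' : IsIntegral ℤ x := by
      refine ⟨X ^ n - X - 1, monic_X_pow_sub_X_sub_one ℤ (by omega), ?_⟩
      have := isRoot_of_mem_roots hx
      simpa using this
    exact ⟨⟨x, hx'⟩, rfl⟩
  have htrans : MulAction.IsPretransitive Gal(L/ℚ) ((X ^ n - X - 1 : ℤ[X]).rootSet (𝓞 L)) := by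
    refine ⟨fun x y ↦ ?_⟩
    have hmin (z : (X ^ n - X - 1 : ℤ[X]).rootSet (𝓞 L)) :
        minpoly ℚ (z.1 : L) = X ^ n - X - 1 := by
      refine minpoly_eq_X_pow_sub_X_sub_one (by omega) ?_
      have := congrArg (algebraMap (𝓞 L) L) ((mem_rootSet_X_pow_sub_X_sub_one (by omega)).mp z.2)
      simpa using this
    obtain ⟨g, hg⟩ := (Normal.minpoly_eq_iff_mem_orbit L).mp ((hmin y).trans (hmin x).symm)
    exact ⟨g, Subtype.ext (RingOfIntegers.coe_injective hg)⟩
  refine hS.surjective_toPermHom_of_iSup_inertia_eq_top (fun m ↦ ?_)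
    (NumberField.iSup_inertia_eq_top L Gal(L/ℚ))
  let := Ideal.Quotient.field m.asIdeal
  refine le_trans ?_ (le_ncard_rootSet_X_pow_sub_X_sub_one_add_one hn ?_)
  · classical
    rw [rootSet_def, Set.ncard_coe_finset]
    refine (Multiset.toFinset_card_le _).trans ((card_roots' _).trans ?_)
    rw [(monic_X_pow_sub_X_sub_one ℤ (by omega)).natDegree_map,
      natDegree_X_pow_sub_X_sub_one ℤ (by omega)]
  · simpa using hS.map (Ideal.Quotient.mk m.asIdeal)

theorem exists_gal_apply_eq_self_and_apply_eq {n : ℕ} (hn : 3 ≤ n) {L : Type*} [Field L]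
    [NumberField L] [IsGalois ℚ L] (hs : ((X ^ n - X - 1 : ℚ[X]).map (algebraMap ℚ L)).Splits)
    {θ x y : L} (hθ : θ ^ n - θ - 1 = 0) (hx : x ^ n - x - 1 = 0) (hy : y ^ n - y - 1 = 0)
    (hxθ : x ≠ θ) (hyθ : y ≠ θ) : ∃ g : Gal(L/ℚ), g θ = θ ∧ g x = y := by
  classical
  have hroot (z : L) (hz : z ^ n - z - 1 = 0) :
      ∃ r : (X ^ n - X - 1 : ℤ[X]).rootSet (𝓞 L), (r.1 : L) = z := by
    have hint : IsIntegral ℤ z :=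
      ⟨X ^ n - X - 1, monic_X_pow_sub_X_sub_one ℤ (by omega), by simpa using hz⟩
    exact ⟨⟨⟨z, hint⟩, (mem_rootSet_X_pow_sub_X_sub_one (by omega)).mpr
      (RingOfIntegers.coe_injective
        (by simp only [map_sub, map_one, map_zero]; exact hz))⟩, rfl⟩
  obtain ⟨t, rfl⟩ := hroot θ hθ
  obtain ⟨x, rfl⟩ := hroot x hx
  obtain ⟨y, rfl⟩ := hroot y hy
  obtain ⟨g, hg⟩ := X_pow_sub_X_sub_one_surjective_toPermHom hn hs (Equiv.swap x y)
  have hg' (z) : g (z.1 : L) = ((Equiv.swap x y z).1 : L) := by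
    rw [← hg]; rfl
  refine ⟨g, ?_, by rw [hg', Equiv.swap_apply_left]⟩
  rw [hg', Equiv.swap_apply_of_ne_of_ne]
  · rintro rfl; exact hxθ rfl
  · rintro rfl; exact hyθ rfl

theorem AlgEquiv.apply_eq_self_of_mem_adjoin_simple {K L : Type*} [Field K] [Field L]
    [Algebra K L] {θ x : L} {g : Gal(L/K)} (hg : g θ = θ) (hx : x ∈ K⟮θ⟯) : g x = x := by
  have hle : K⟮θ⟯ ≤ fixedField (Subgroup.zpowers g) := by
    rw [adjoin_simple_le_iff, mem_fixedField_iff]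
    intro f hf
    exact (Subgroup.zpowers_le (H := stabilizer Gal(L/K) θ)).mpr hg hf
  exact (mem_fixedField_iff _ _).mp (hle hx) g (Subgroup.mem_zpowers g)

theorem IntermediateField.eq_bot_or_eq_adjoin_simple_of_le {K L : Type*} [Field K] [Field L]
    [Algebra K L] [FiniteDimensional K L] [IsGalois K L] {θ : L}
    (h : ∀ x ∈ orbit Gal(L/K) θ, ∀ y ∈ orbit Gal(L/K) θ, x ≠ θ → y ≠ θ →
      ∃ g : Gal(L/K), g θ = θ ∧ g x = y)
    {F : IntermediateField K L} (hF : F ≤ K⟮θ⟯) : F = ⊥ ∨ F = K⟮θ⟯ := by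
  by_cases hfix : ∀ σ ∈ F.fixingSubgroup, σ θ = θ
  · refine Or.inr (hF.antisymm ?_)
    rw [adjoin_simple_le_iff, ← IsGalois.fixedField_fixingSubgroup F, mem_fixedField_iff]
    exact hfix
  push Not at hfix
  obtain ⟨σ, hσ, hσθ⟩ := hfix
  have hstab (g : Gal(L/K)) (hg : g θ = θ) : g ∈ F.fixingSubgroup := by
    refine fixingSubgroup_le hF ?_
    rw [mem_fixingSubgroup_iff]
    exact fun x hx ↦ AlgEquiv.apply_eq_self_of_mem_adjoin_simple hg hx
  have htop : F.fixingSubgroup = ⊤ := by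
    refine (Subgroup.eq_top_iff' _).mpr fun g ↦ ?_
    by_cases hg : g θ = θ
    · exact hstab g hg
    obtain ⟨τ, hτ, hτσ⟩ := h (σ θ) ⟨σ, rfl⟩ (g θ) ⟨g, rfl⟩ hσθ hg
    have hmem : (τ * σ)⁻¹ * g ∈ F.fixingSubgroup := by
      refine hstab _ ?_
      change (τ * σ)⁻¹ (g θ) = θ
      rw [← hτσ]
      exact (τ * σ).symm_apply_apply θ
    exact (Subgroup.mul_mem_cancel_left _ (inv_mem (mul_mem (hstab τ hτ) hσ))).mp hmem
  left
  rw [← IsGalois.fixedField_fixingSubgroup F, htop, IsGalois.fixedField_top]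

theorem IntermediateField.not_normal_adjoin_simple {K L : Type*} [Field K] [Field L]
    [Algebra K L] [Normal K L] {θ x : L} (hx : x ∈ orbit Gal(L/K) θ) {g : Gal(L/K)}
    (hg : g θ = θ) (hgx : g x ≠ x) : ¬ Normal K K⟮θ⟯ := by
  intro hnormal
  obtain ⟨σ, rfl⟩ := hx
  have hmem : σ θ ∈ K⟮θ⟯ :=
    normal_iff_forall_map_le'.mp hnormal σ ⟨θ, mem_adjoin_simple_self K θ, rfl⟩
  exact hgx (AlgEquiv.apply_eq_self_of_mem_adjoin_simple hg hmem)

theorem X_pow_sub_X_sub_one_exists_roots {n : ℕ} (hn : 3 ≤ n) {L : Type*} [Field L] [CharZero L]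
    (hs : ((X ^ n - X - 1 : ℚ[X]).map (algebraMap ℚ L)).Splits) (θ : L) :
    ∃ x y : L, x ≠ θ ∧ y ≠ θ ∧ x ≠ y ∧ x ^ n - x - 1 = 0 ∧ y ^ n - y - 1 = 0 := by
  have hcard := card_rootSet_eq_natDegree
    (X_pow_sub_X_sub_one_irreducible_rat (n := n) (by omega)).separable hs
  rw [natDegree_X_pow_sub_X_sub_one ℚ (by omega), ← Nat.card_eq_fintype_card,
    Nat.card_coe_set_eq] at hcard
  have h1 := Set.pred_ncard_le_ncard_sdiff_singleton ((X ^ n - X - 1 : ℚ[X]).rootSet L) θ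
  obtain ⟨x, hx, y, hy, hxy⟩ :=
    (Set.one_lt_ncard (s := (X ^ n - X - 1 : ℚ[X]).rootSet L \ {θ})).mp (by omega)
  exact ⟨x, y, hx.2, hy.2, hxy, (mem_rootSet_X_pow_sub_X_sub_one (by omega)).mp hx.1,
    (mem_rootSet_X_pow_sub_X_sub_one (by omega)).mp hy.1⟩

/-- For every integer `n ≥ 3` and every complex root `θ` of `X^n - X - 1`, the extension
`ℚ(θ)/ℚ` is simple but not Galois: `ℚ(θ) ≠ ℚ`, the only intermediate fields between `ℚ`
and `ℚ(θ)` are `ℚ` and `ℚ(θ)`, and `ℚ(θ)/ℚ` is not normal. -/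
theorem simple_not_galois_selmer (n : ℕ) (hn : 3 ≤ n) (θ : ℂ)
    (hθ : θ ^ n - θ - 1 = 0) :
    IntermediateField.adjoin ℚ {θ} ≠ ⊥ ∧
    (∀ F : IntermediateField ℚ ℂ, F ≤ IntermediateField.adjoin ℚ {θ} →
      F = ⊥ ∨ F = IntermediateField.adjoin ℚ {θ}) ∧
    ¬ Normal ℚ (IntermediateField.adjoin ℚ {θ}) := by
  have hs : ((X ^ n - X - 1 : ℚ[X]).map (algebraMap ℚ ℂ)).Splits := IsAlgClosed.splits _
  obtain ⟨L, hL⟩ : ∃ L : IntermediateField ℚ ℂ,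
      L = IntermediateField.adjoin ℚ ((X ^ n - X - 1 : ℚ[X]).rootSet ℂ) := ⟨_, rfl⟩
  have : IsSplittingField ℚ L (X ^ n - X - 1 : ℚ[X]) :=
    hL ▸ IntermediateField.adjoin_rootSet_isSplittingField hs
  have : FiniteDimensional ℚ L := IsSplittingField.finiteDimensional L (X ^ n - X - 1)
  have : NumberField L := {}
  have : Normal ℚ L := Normal.of_isSplittingField (X ^ n - X - 1)
  have : IsGalois ℚ L := {}
  have hsL := IsSplittingField.splits L (X ^ n - X - 1 : ℚ[X])
  have hθL : θ ∈ L := by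
    rw [hL]
    exact IntermediateField.subset_adjoin _ _
      ((mem_rootSet_X_pow_sub_X_sub_one (by omega)).mpr hθ)
  obtain ⟨t, rfl⟩ : ∃ t : L, (t : ℂ) = θ := ⟨⟨θ, hθL⟩, rfl⟩
  have ht : t ^ n - t - 1 = 0 := Subtype.ext (by simpa using hθ)
  have hlift : IntermediateField.lift ℚ⟮t⟯ = ℚ⟮(t : ℂ)⟯ := IntermediateField.lift_adjoin_simple ..
  have horbit (x : L) : x ∈ orbit Gal(L/ℚ) t ↔ x ^ n - x - 1 = 0 := by
    have hmin := minpoly_eq_X_pow_sub_X_sub_one (by omega) ht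
    rw [← Normal.minpoly_eq_iff_mem_orbit L, hmin]
    refine ⟨fun h ↦ ?_, fun h ↦ minpoly_eq_X_pow_sub_X_sub_one (by omega) h⟩
    have := minpoly.aeval ℚ x
    rw [h] at this
    simpa using this
  have hnormal : ¬ Normal ℚ ℚ⟮(t : ℂ)⟯ := by
    obtain ⟨x, y, hxt, hyt, hxy, hx, hy⟩ := X_pow_sub_X_sub_one_exists_roots hn hsL t
    obtain ⟨g, hgt, hgx⟩ := exists_gal_apply_eq_self_and_apply_eq hn hsL ht hx hy hxt hyt
    intro hN
    refine IntermediateField.not_normal_adjoin_simple ((horbit x).mpr hx) hgt (hgx ▸ hxy.symm) ?_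
    exact @Normal.of_algEquiv _ _ _ _ _ _ _ _ hN
      ((IntermediateField.equivOfEq hlift.symm).trans (liftAlgEquiv ℚ⟮t⟯).symm)
  refine ⟨fun h ↦ hnormal (h ▸ Normal.of_algEquiv (botEquiv ℚ ℂ).symm), fun F hF ↦ ?_, hnormal⟩
  have hFL : F ≤ L := hF.trans (by simp)
  have hrestrict : restrict hFL ≤ ℚ⟮t⟯ :=
    fun x hx ↦ (IntermediateField.mem_lift x).mp (hlift ▸ hF ((mem_restrict hFL x).mp hx))
  rcases eq_bot_or_eq_adjoin_simple_of_le
    (fun x hx y hy ↦ exists_gal_apply_eq_self_and_apply_eq hn hsL ht ((horbit x).mp hx)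
      ((horbit y).mp hy)) hrestrict with h | h
  · left
    exact (lift_restrict hFL).symm.trans ((congrArg lift h).trans (lift_bot ..))
  · right
    exact (lift_restrict hFL).symm.trans ((congrArg lift h).trans hlift)
end

section
/- Let n ≥ 3 be an odd integer and let a be a positive rational number such that for every divisor d of n with d > 1, a is not a d-th power in ℚ. Let α be the positive real n-th root of a (so α ∈ ℝ and α^n = a). Then the extension ℚ(α)/ℚ is galsimple and not Galois. -/
open Polynomial IntermediateField

lemma IntermediateField.adjoin_gen_eq_top {K E : Type*} [Field K] [Field E] [Algebra K E]
    (x : E) :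
    K⟮AdjoinSimple.gen K x⟯ = ⊤ :=
  lift_injective _ (by rw [lift_adjoin_simple, lift_top, AdjoinSimple.coe_gen])

/-- If `L = ℚ(x)` is real and `x ^ n` is rational, every intermediate field `F` contains
`x ^ [L : F]`. -/
lemma IntermediateField.pow_finrank_mem_of_adjoin_eq_top {L : Type*} [Field L] [Algebra ℚ L]
    (φ : L →+* ℝ) {n : ℕ} (hn : n ≠ 0) {a : ℚ} {x : L} (hx : 0 < φ x)
    (hxn : x ^ n = algebraMap ℚ L a) (htop : ℚ⟮x⟯ = ⊤) (F : IntermediateField ℚ L) :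
    x ^ Module.finrank F L ∈ F := by
  have hroot : aeval x (X ^ n - C (algebraMap ℚ F a)) = 0 := by
    simp only [map_sub, map_pow, aeval_X, aeval_C, hxn]
    rw [← IsScalarTower.algebraMap_apply, sub_self]
  have hxint : IsIntegral F x := ⟨_, monic_X_pow_sub_C _ hn, hroot⟩
  have htop' : F⟮x⟯ = ⊤ := by
    rw [← restrictScalars_eq_top_iff (K := ℚ), eq_top_iff, ← htop, adjoin_simple_le_iff]
    exact mem_adjoin_simple_self F x
  have hdeg : (minpoly F x).natDegree = Module.finrank F L := by
    rw [← adjoin.finrank hxint, htop', finrank_top']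
  let ψ : F →+* ℂ := (Complex.ofRealHom.comp φ).comp (algebraMap F L)
  have hmonic : ((minpoly F x).map ψ).Monic := (minpoly.monic hxint).map ψ
  have hroots : ∀ r ∈ ((minpoly F x).map ψ).roots, ‖r‖ = φ x := by
    intro r hr
    have h0 := eval_eq_zero_of_dvd_of_eval_eq_zero
      (map_dvd ψ (minpoly.dvd F x hroot)) (isRoot_of_mem_roots hr)
    have h1 : r ^ n = ((φ x : ℝ) : ℂ) ^ n := by
      have h2 : ψ (algebraMap ℚ F a) = ((φ x : ℝ) : ℂ) ^ n := by
        have h3 : algebraMap F L (algebraMap ℚ F a) = x ^ n := by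
          rw [hxn, ← IsScalarTower.algebraMap_apply]
        change ((φ (algebraMap F L (algebraMap ℚ F a)) : ℝ) : ℂ) = _
        rw [h3]
        push_cast [map_pow]
        rfl
      rw [← h2]
      simpa [sub_eq_zero] using h0
    have h4 : ‖r‖ ^ n = φ x ^ n := by
      rw [← norm_pow, h1, norm_pow, Complex.norm_real, Real.norm_of_nonneg hx.le]
    exact (pow_left_inj₀ (norm_nonneg r) hx.le hn).1 h4
  have hsplit := IsAlgClosed.splits ((minpoly F x).map ψ)
  have hnorm : |φ ((minpoly F x).coeff 0 : L)| = φ x ^ Module.finrank F L := by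
    have h := hsplit.coeff_zero_eq_prod_roots_of_monic hmonic
    have hprod : ‖((minpoly F x).map ψ).roots.prod‖ = φ x ^ Module.finrank F L := by
      have h5 : (((minpoly F x).map ψ).roots.map (fun r => ‖r‖)) =
          Multiset.replicate (Module.finrank F L) (φ x) := by
        rw [Multiset.map_congr rfl hroots, Multiset.map_const', ← hsplit.natDegree_eq_card_roots,
          natDegree_map, hdeg]
      have h6 := map_multiset_prod (normHom : ℂ →*₀ ℝ) ((minpoly F x).map ψ).roots
      exact h6.trans ((congrArg Multiset.prod h5).trans (Multiset.prod_replicate _ _))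
    have h7 := congrArg norm h
    rw [norm_mul, norm_pow, norm_neg, norm_one, one_pow, one_mul, hprod, coeff_map] at h7
    rw [← h7]
    exact (Complex.norm_real _).symm
  rw [← map_pow] at hnorm
  rcases abs_choice (φ ((minpoly F x).coeff 0 : L)) with h | h
  · rw [← φ.injective (h.symm.trans hnorm)]
    exact ((minpoly F x).coeff 0).2
  · rw [h, ← map_neg] at hnorm
    rw [← φ.injective hnorm]
    exact neg_mem ((minpoly F x).coeff 0).2

/-- A real field that is normal over `ℚ` and contains a root of an irreducible polynomial
`X ^ e - a` with `e` odd forces `e = 1`. -/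
lemma eq_one_of_irreducible_X_pow_sub_C_of_normal {F : Type*} [Field F] [Algebra ℚ F]
    [Normal ℚ F] (φ : F →+* ℝ) {e : ℕ} (he : Odd e) {a : ℚ} {y : F}
    (hirr : Irreducible (X ^ e - C a)) (hy : y ^ e = algebraMap ℚ F a) : e = 1 := by
  have hmin : X ^ e - C a = minpoly ℚ y :=
    minpoly.eq_of_irreducible_of_monic hirr (by simp [hy]) (monic_X_pow_sub_C a he.pos.ne')
  have hsplit := Normal.splits (F := ℚ) (K := F) inferInstance y
  have hnodup : ((minpoly ℚ y).map (algebraMap ℚ F)).roots.Nodup :=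
    nodup_roots ((hmin ▸ hirr).separable.map)
  have hcard := hsplit.natDegree_eq_card_roots
  have hall : ∀ r ∈ ((minpoly ℚ y).map (algebraMap ℚ F)).roots, r = y := by
    intro r hr
    have h0 := isRoot_of_mem_roots hr
    rw [← hmin] at h0
    have h1 : r ^ e = y ^ e := by
      rw [hy]
      simpa [IsRoot, sub_eq_zero] using h0
    apply φ.injective
    apply he.strictMono_pow.injective
    simp only [← map_pow, h1]
  have hle : ((minpoly ℚ y).map (algebraMap ℚ F)).roots.card ≤ 1 := by
    classical
    have h2 := Multiset.nodup_iff_count_le_one.1 hnodup y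
    rwa [Multiset.count_eq_card.2 fun r hr => (hall r hr).symm] at h2
  rw [← hcard, natDegree_map, ← hmin, natDegree_X_pow_sub_C] at hle
  have := he.pos
  omega

/-- Let `n ≥ 3` be odd and `a` a positive rational which is not a `d`-th power in `ℚ` for
any divisor `d > 1` of `n`.  Let `α` be the positive real `n`-th root of `a`.  Then
`ℚ(α)/ℚ` is galsimple and not Galois. -/
theorem galsimple_not_galois_radical (n : ℕ) (hn : 3 ≤ n) (hodd : Odd n)
    (a : ℚ) (ha : 0 < a)
    (hpow : ∀ d : ℕ, d ∣ n → 1 < d → ¬ ∃ b : ℚ, b ^ d = a)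
    (α : ℝ) (hα : 0 < α) (hαn : α ^ n = (a : ℝ)) :
    Galsimple ℚ (IntermediateField.adjoin ℚ {α}) ∧
    ¬ IsGalois ℚ (IntermediateField.adjoin ℚ {α}) := by
  have hn0 : n ≠ 0 := by omega
  have hirr : ∀ e, e ∣ n → Irreducible (X ^ e - C a) := fun e hen =>
    X_pow_sub_C_irreducible_of_odd (hodd.of_dvd_nat hen) fun p hp hpe b hb =>
      hpow p (hpe.trans hen) hp.one_lt ⟨b, hb⟩
  have hαint : IsIntegral ℚ α := ⟨_, monic_X_pow_sub_C a hn0, by simp [hαn]⟩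
  have hfin : Module.finrank ℚ ℚ⟮α⟯ = n := by
    rw [adjoin.finrank hαint, ← minpoly.eq_of_irreducible_of_monic (hirr n dvd_rfl)
      (by simp [hαn]) (monic_X_pow_sub_C a hn0), natDegree_X_pow_sub_C]
  have hgen : AdjoinSimple.gen ℚ α ^ n = algebraMap ℚ ℚ⟮α⟯ a := by
    apply (algebraMap ℚ⟮α⟯ ℝ).injective
    rw [map_pow, AdjoinSimple.algebraMap_gen, hαn, ← IsScalarTower.algebraMap_apply]
    rfl
  have hgalois : ∀ F : IntermediateField ℚ ℚ⟮α⟯, IsGalois ℚ F → F = ⊥ := by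
    intro F _
    have hmem := pow_finrank_mem_of_adjoin_eq_top (algebraMap ℚ⟮α⟯ ℝ) hn0
      (by simpa using hα) hgen (adjoin_gen_eq_top α) F
    have hmul : Module.finrank ℚ F * Module.finrank F ℚ⟮α⟯ = n :=
      (Module.finrank_mul_finrank ℚ F ℚ⟮α⟯).trans hfin
    have hdvd := Dvd.intro _ hmul
    rw [← IntermediateField.finrank_eq_one_iff]
    refine eq_one_of_irreducible_X_pow_sub_C_of_normal (y := ⟨_, hmem⟩)
      ((algebraMap ℚ⟮α⟯ ℝ).comp (algebraMap F ℚ⟮α⟯)) (hodd.of_dvd_nat hdvd) (hirr _ hdvd) ?_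
    apply Subtype.ext
    change (AdjoinSimple.gen ℚ α ^ _) ^ _ = algebraMap ℚ ℚ⟮α⟯ a
    rw [← pow_mul, mul_comm, hmul, hgen]
  have hne : (⊥ : IntermediateField ℚ ℚ⟮α⟯) ≠ ⊤ := by
    intro h
    have h1 : Module.finrank ℚ (⊥ : IntermediateField ℚ ℚ⟮α⟯) = 1 := IntermediateField.finrank_bot
    rw [h, finrank_top', hfin] at h1
    omega
  refine ⟨⟨hne, fun F hF => Or.inl (hgalois F hF)⟩, fun h => hne (hgalois ⊤ ?_).symm⟩
  exact IsGalois.of_algEquiv topEquiv.symm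
end
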